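/- arXiv:1111.0587 — 4 statements merged into one kernel-verified Lean document; each statement's English description precedes it below -/
import Mathlib

section
/- Let m ≥ 4 and let C be an m×n binary 2-covering array such that wt(c^i) ≤ ⌊m/2⌋ for every column c^i of C and such that the intersection ⋂_{1≤i≤n} supp(c^i) of the supports of all columns is empty. Then n ≤ binom(m−1, ⌊m/2⌋−1) if m is even, and n ≤ binom(m−1, ⌊m/2⌋−1) − ⌊m/2⌋ + 1 if m is odd. Moreover, the inequality is strict if wt(c^i) < ⌊m/2⌋ for some column c^i. -/
/-- An `m × n` matrix over `B_q = {0,…,q-1}` is a `t`-covering array if for any `t`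
distinct column indices and any `q`-ary vector of length `t`, some row realizes it. -/
def IsCoveringArray (m n q t : ℕ) (C : Fin m → Fin n → Fin q) : Prop :=
  ∀ cols : Fin t → Fin n, Function.Injective cols →
    ∀ v : Fin t → Fin q, ∃ r : Fin m, ∀ j : Fin t, C r (cols j) = v j

/-- `CAN t n q` : the minimal size `m` for which a `CA(m; t, n, q)` exists. -/
noncomputable def CAN (t n q : ℕ) : ℕ :=
  sInf { m | ∃ C : Fin m → Fin n → Fin q, IsCoveringArray m n q t C }

/-- The weight of the `i`-th column: the number of nonzero entries. -/
def colWt {m n q : ℕ} (C : Fin m → Fin n → Fin q) (i : Fin n) : ℕ :=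
  (Finset.univ.filter fun r : Fin m => (C r i : ℕ) ≠ 0).card

/-- The support of the `i`-th column: the set of coordinates where it is nonzero. -/
def colSupp {m n q : ℕ} (C : Fin m → Fin n → Fin q) (i : Fin n) : Finset (Fin m) :=
  Finset.univ.filter fun r : Fin m => (C r i : ℕ) ≠ 0

/-- The Hamming distance between the `i`-th and `j`-th columns. -/
def colDist {m n q : ℕ} (C : Fin m → Fin n → Fin q) (i j : Fin n) : ℕ :=
  (Finset.univ.filter fun r : Fin m => C r i ≠ C r j).card

/-- Two arrays are equivalent if one is obtained from the other by a row permutation,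
a column permutation, and value permutations applied columnwise. -/
def CAEquiv {m n q : ℕ} (C C' : Fin m → Fin n → Fin q) : Prop :=
  ∃ (σ : Equiv.Perm (Fin m)) (τ : Equiv.Perm (Fin n)) (f : Fin n → Equiv.Perm (Fin q)),
    ∀ r i, C' r i = f i (C (σ r) (τ i))

/-- The standard maximal binary 2-covering array of size `m` : an
`m × (m-1).choose (m/2 - 1)` binary matrix whose first row is all ones and whose columns,
restricted to the remaining `m - 1` rows, are exactly (i.e. are pairwise distinct) the binary
vectors of length `m-1` with `m/2 - 1` ones. -/
def IsStandardMaxArray (m : ℕ) (S : Fin m → Fin ((m-1).choose (m/2 - 1)) → Fin 2) : Prop :=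
  (∀ (r : Fin m) (i), (r : ℕ) = 0 → S r i = 1) ∧
  (Function.Injective fun i => fun r => S r i) ∧
  (∀ i, (Finset.univ.filter fun r : Fin m => (r : ℕ) ≠ 0 ∧ S r i = 1).card = m/2 - 1)

namespace Finset

variable {α : Type*} [DecidableEq α]

/-- Replace `j` by `i` in `A` whenever this is possible. -/
def shiftSet (i j : α) (A : Finset α) : Finset α :=
  if j ∈ A ∧ i ∉ A then insert i (A.erase j) else A

/-- Shift a member of the family `F`, unless the shifted set already belongs to `F`. -/
def shiftIn (F : Finset (Finset α)) (i j : α) (A : Finset α) : Finset α :=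
  if shiftSet i j A ∈ F then A else shiftSet i j A

/-- The `(i, j)`-shift of a family of finite sets. -/
def shiftFamily (F : Finset (Finset α)) (i j : α) : Finset (Finset α) :=
  F.image (shiftIn F i j)

variable {F : Finset (Finset α)} {i j : α} {A : Finset α} {k : ℕ}

lemma card_shiftSet : (shiftSet i j A).card = A.card := by
  unfold shiftSet
  split_ifs with h
  · rw [card_insert_of_notMem (by simp [h.2]), card_erase_add_one h.1]
  · rfl

lemma card_shiftIn : (shiftIn F i j A).card = A.card := by
  unfold shiftIn
  split_ifs
  · rfl
  · exact card_shiftSet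

lemma shiftIn_injOn : Set.InjOn (shiftIn F i j) F := by
  intro A hA B hB h
  simp only [shiftIn, shiftSet, mem_coe] at *
  ext x
  have hx := congrArg (fun C : Finset α => x ∈ C) h
  have hi := congrArg (fun C : Finset α => i ∈ C) h
  have hj := congrArg (fun C : Finset α => j ∈ C) h
  grind

lemma card_shiftFamily : (shiftFamily F i j).card = F.card :=
  card_image_of_injOn shiftIn_injOn

lemma sized_shiftFamily (h : (F : Set (Finset α)).Sized k) :
    (shiftFamily F i j : Set (Finset α)).Sized k := by
  intro A hA
  simp only [shiftFamily, coe_image, Set.mem_image] at hA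
  obtain ⟨B, hB, rfl⟩ := hA
  rw [card_shiftIn, h hB]

lemma intersecting_shiftFamily (h : (F : Set (Finset α)).Intersecting) :
    (shiftFamily F i j : Set (Finset α)).Intersecting := by
  have key : ∀ A ∈ F, ∀ B ∈ F, shiftSet i j A ∈ F → shiftSet i j B ∉ F →
      ¬ Disjoint A (shiftSet i j B) := by
    intro A hA B hB hA' hB' hd
    have h1 := h (mem_coe.2 hA) (mem_coe.2 hB)
    have h2 := h (mem_coe.2 hA') (mem_coe.2 hB)
    rw [not_disjoint_iff] at h1 h2
    rw [disjoint_left] at hd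
    simp only [shiftSet] at *
    grind
  intro A hA B hB hd
  simp only [shiftFamily, coe_image, Set.mem_image, mem_coe] at hA hB
  obtain ⟨A, hA, rfl⟩ := hA
  obtain ⟨B, hB, rfl⟩ := hB
  by_cases hA' : shiftSet i j A ∈ F <;> by_cases hB' : shiftSet i j B ∈ F <;>
    simp only [shiftIn, hA', hB', if_true, if_false] at hd
  · exact h hA hB hd
  · exact key A hA B hB hA' hB' hd
  · exact key B hB A hA hB' hA' hd.symm
  · rw [disjoint_left] at hd
    simp only [shiftSet] at *
    grind

lemma mem_shiftFamily_of_shiftSet_mem (hA : A ∈ F) (h : shiftSet i j A ∈ F) :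
    A ∈ shiftFamily F i j :=
  mem_image.2 ⟨A, hA, if_pos h⟩

/-- The total weight of a family of sets. -/
def familyWeight (e : α → ℕ) (F : Finset (Finset α)) : ℕ := ∑ A ∈ F, ∑ x ∈ A, e x

lemma sum_shiftSet_lt {e : α → ℕ} (he : e i < e j) (h : shiftSet i j A ≠ A) :
    ∑ x ∈ shiftSet i j A, e x < ∑ x ∈ A, e x := by
  unfold shiftSet at *
  split_ifs at * with hA
  · rw [sum_insert (by simp [hA.2]), ← add_sum_erase A e hA.1]
    omega
  · exact absurd rfl h

lemma familyWeight_shiftFamily_lt {e : α → ℕ} (he : e i < e j) (hA : A ∈ F)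
    (h : shiftSet i j A ∉ F) : familyWeight e (shiftFamily F i j) < familyWeight e F := by
  unfold familyWeight shiftFamily
  rw [sum_image shiftIn_injOn]
  have aux : ∀ B ∈ F, shiftSet i j B ∉ F → ∑ x ∈ shiftIn F i j B, e x < ∑ x ∈ B, e x := by
    intro B hB hB'
    rw [shiftIn, if_neg hB']
    exact sum_shiftSet_lt he fun h' => hB' (h'.symm ▸ hB)
  refine sum_lt_sum (fun B hB => ?_) ⟨A, hA, aux A hA h⟩
  by_cases hB' : shiftSet i j B ∈ F
  · rw [shiftIn, if_pos hB']
  · exact (aux B hB hB').le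

/-- Repeated shifting within a class of families ends in a family all of whose shifts are trivial
or leave the class. -/
lemma exists_stable (P : Finset (Finset α) → Prop) (R : α → α → Prop) (e : α → ℕ)
    (hR : ∀ i j, R i j → e i < e j) (hF : P F) :
    ∃ G, P G ∧ G.card = F.card ∧
      ∀ i j, R i j → P (shiftFamily G i j) → ∀ A ∈ G, shiftSet i j A ∈ G := by
  induction hw : familyWeight e F using Nat.strong_induction_on generalizing F with
  | _ w ih =>
    by_cases h : ∀ i j, R i j → P (shiftFamily F i j) → ∀ A ∈ F, shiftSet i j A ∈ F
    · exact ⟨F, hF, rfl, h⟩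
    · push Not at h
      obtain ⟨i, j, hij, hP, A, hA, hA'⟩ := h
      obtain ⟨G, hG, hc, hs⟩ :=
        ih _ (hw ▸ familyWeight_shiftFamily_lt (hR i j hij) hA hA') hP rfl
      exact ⟨G, hG, hc.trans card_shiftFamily, hs⟩

lemma two_mul_card_le_choose_of_intersecting {S : Finset α} (hS : S.card = 2 * k)
    (hk : (F : Set (Finset α)).Sized k) (hFS : ∀ A ∈ F, A ⊆ S)
    (hint : (F : Set (Finset α)).Intersecting) : 2 * F.card ≤ (2 * k).choose k := by
  have hinj : Set.InjOn (fun A => S \ A) (F : Set (Finset α)) := by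
    intro A hA B hB h
    have h' : S \ (S \ A) = S \ (S \ B) := congrArg (S \ ·) h
    rwa [sdiff_sdiff_eq_self (hFS A hA), sdiff_sdiff_eq_self (hFS B hB)] at h'
  have hd : Disjoint F (F.image (fun A => S \ A)) := by
    rw [disjoint_left]
    intro A hA hA'
    obtain ⟨B, hB, rfl⟩ := mem_image.1 hA'
    exact hint hA hB sdiff_disjoint
  have hsub : F ∪ F.image (fun A => S \ A) ⊆ S.powersetCard k := by
    intro A hA
    rw [mem_powersetCard]
    rcases mem_union.1 hA with hA | hA
    · exact ⟨hFS A hA, hk hA⟩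
    · obtain ⟨B, hB, rfl⟩ := mem_image.1 hA
      refine ⟨sdiff_subset, ?_⟩
      rw [card_sdiff_of_subset (hFS B hB), hk hB]
      omega
  have := card_le_card hsub
  rw [card_union_of_disjoint hd, card_image_of_injOn hinj, card_powersetCard, hS] at this
  omega

lemma card_le_choose_of_intersecting {S : Finset α} (hS : S.card = 2 * (k + 1))
    (hk : (F : Set (Finset α)).Sized (k + 1)) (hFS : ∀ A ∈ F, A ⊆ S)
    (hint : (F : Set (Finset α)).Intersecting) : F.card ≤ (2 * k + 1).choose k := by
  have h := two_mul_card_le_choose_of_intersecting hS hk hFS hint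
  have h1 : (2 * (k + 1)).choose (k + 1) = (2 * k + 1).choose k + (2 * k + 1).choose (k + 1) :=
    Nat.choose_succ_succ (2 * k + 1) k
  have h2 : (2 * k + 1).choose (k + 1) = (2 * k + 1).choose k := Nat.choose_symm_half k
  omega

/-- A family on the ground set `S` is shifted with respect to the order induced by `e` if it is
closed under replacing an element of a member by a smaller one. -/
def IsShifted (e : α → ℕ) (S : Finset α) (F : Finset (Finset α)) : Prop :=
  ∀ A ∈ F, ∀ i ∈ S, ∀ j ∈ A, e i < e j → i ∉ A → insert i (A.erase j) ∈ F

lemma mem_of_isShifted_of_sized_one {e : α → ℕ} (he : e.Injective) {S : Finset α}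
    (hk : (F : Set (Finset α)).Sized 1) (hFS : ∀ A ∈ F, A ⊆ S)
    (hint : (F : Set (Finset α)).Intersecting) (hsh : IsShifted e S F) {o : α} (ho : o ∈ S)
    (hmin : ∀ x ∈ S, e o ≤ e x) {A : Finset α} (hA : A ∈ F) : o ∈ A := by
  obtain ⟨b, rfl⟩ := card_eq_one.1 (hk hA)
  by_contra hob
  have hne : o ≠ b := by simpa using hob
  have hlt : e o < e b := lt_of_le_of_ne (hmin b (hFS _ hA (by simp))) fun h => hne (he h)
  have h := hsh _ hA o ho b (by simp) hlt hob
  refine hint h hA ?_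
  simp [hne]

/-- The members of a star that meet a fixed set avoiding its centre. -/
lemma card_add_choose_le_of_star {S B : Finset α} {N : ℕ} (hS : S.card = N + 1)
    (hk : (F : Set (Finset α)).Sized (k + 1)) (hFS : ∀ A ∈ F, A ⊆ S) {o : α} (ho : o ∈ S)
    (hFo : ∀ A ∈ F, o ∈ A) (hB : B ⊆ S) (hoB : o ∉ B) (hFB : ∀ A ∈ F, ¬ Disjoint A B) :
    F.card + (N - B.card).choose k ≤ N.choose k := by
  have hinj : Set.InjOn (fun A => A.erase o) (F : Set (Finset α)) := by
    intro A hA A' hA' h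
    rw [← insert_erase (hFo A hA), ← insert_erase (hFo A' hA')]
    exact congrArg (insert o) h
  have hd : Disjoint (F.image (fun A => A.erase o)) (powersetCard k (S.erase o \ B)) := by
    rw [disjoint_left]
    intro X hX hX'
    obtain ⟨A, hA, rfl⟩ := mem_image.1 hX
    refine hFB A hA (disjoint_left.2 fun x hx hxB => ?_)
    have hxo : x ≠ o := fun h => hoB (h ▸ hxB)
    exact (mem_sdiff.1 ((mem_powersetCard.1 hX').1 (mem_erase.2 ⟨hxo, hx⟩))).2 hxB
  have hsub : F.image (fun A => A.erase o) ∪ powersetCard k (S.erase o \ B) ⊆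
      powersetCard k (S.erase o) := by
    intro X hX
    rcases mem_union.1 hX with hX | hX
    · obtain ⟨A, hA, rfl⟩ := mem_image.1 hX
      rw [mem_powersetCard, card_erase_of_mem (hFo A hA), hk hA]
      exact ⟨erase_subset_erase o (hFS A hA), rfl⟩
    · exact powersetCard_mono sdiff_subset hX
  have := card_le_card hsub
  rwa [card_union_of_disjoint hd, card_image_of_injOn hinj, card_powersetCard, card_powersetCard,
    card_sdiff_of_subset (subset_erase.2 ⟨hB, hoB⟩), card_erase_of_mem ho, hS,
    Nat.add_sub_cancel] at this

/-- The Hilton–Milner bound for shifted families. -/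
lemma card_add_choose_le_of_isShifted {e : α → ℕ} (he : e.Injective) {N : ℕ} {S : Finset α}
    (hN : 2 * k + 1 ≤ N) (hS : S.card = N + 1)
    (hk : (F : Set (Finset α)).Sized (k + 1)) (hFS : ∀ A ∈ F, A ⊆ S)
    (hint : (F : Set (Finset α)).Intersecting) (hsh : IsShifted e S F) {o : α} (ho : o ∈ S)
    (hmin : ∀ x ∈ S, e o ≤ e x) (hB : ∃ B ∈ F, o ∉ B) :
    F.card + (N - 1 - k).choose k ≤ N.choose k + 1 := by
  induction N generalizing k S F with
  | zero => omega
  | succ N ih =>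
    rcases hN.eq_or_lt with hN' | hN'
    · have h := card_le_choose_of_intersecting (by omega) hk hFS hint
      have h1 : N + 1 - 1 - k = k := by omega
      rw [h1, Nat.choose_self, ← hN']
      omega
    obtain ⟨t, ht, htmax⟩ := exists_max_image S e ⟨o, ho⟩
    have hot : o ≠ t := by
      rintro rfl
      have : S.card ≤ 1 := card_le_one.2 fun x hx y hy =>
        he (((htmax x hx).antisymm (hmin x hx)).trans ((hmin y hy).antisymm (htmax y hy)))
      omega
    have hlt : ∀ x ∈ S, x ≠ t → e x < e t := fun x hx hxt =>
      lt_of_le_of_ne (htmax x hx) fun h => hxt (he h)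
    obtain _ | l := k
    · obtain ⟨B, hBF, hoB⟩ := hB
      exact absurd (mem_of_isShifted_of_sized_one he hk hFS hint hsh ho hmin hBF) hoB
    have hS' : (S.erase t).card = N + 1 := by rw [card_erase_of_mem ht, hS]; rfl
    have ho' : o ∈ S.erase t := mem_erase.2 ⟨hot, ho⟩
    have hmin' : ∀ x ∈ S.erase t, e o ≤ e x := fun x hx => hmin x (mem_of_mem_erase hx)
    set F₀ := F.filter (t ∉ ·) with hF₀
    set F₁ := (F.filter (t ∈ ·)).image (·.erase t) with hF₁
    have hcard : F.card = F₀.card + F₁.card := by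
      rw [hF₁, card_image_of_injOn, add_comm, card_filter_add_card_filter_not]
      intro A hA A' hA' h
      rw [← insert_erase (mem_filter.1 hA).2, ← insert_erase (mem_filter.1 hA').2]
      exact congrArg (insert t) h
    have mem₁ : ∀ A, A ∈ F₁ ↔ t ∉ A ∧ insert t A ∈ F := by
      intro A
      simp only [hF₁, mem_image, mem_filter]
      constructor
      · rintro ⟨A, ⟨hA, htA⟩, rfl⟩
        exact ⟨notMem_erase t A, by rwa [insert_erase htA]⟩
      · rintro ⟨htA, hA⟩
        exact ⟨_, ⟨hA, mem_insert_self t A⟩, erase_insert htA⟩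
    have hk₁ : (F₁ : Set (Finset α)).Sized (l + 1) := by
      intro A hA
      obtain ⟨htA, hA⟩ := (mem₁ A).1 hA
      have := hk hA
      rw [card_insert_of_notMem htA] at this
      omega
    have hFS₁ : ∀ A ∈ F₁, A ⊆ S.erase t := by
      intro A hA
      obtain ⟨htA, hA⟩ := (mem₁ A).1 hA
      exact subset_erase.2 ⟨(subset_insert t A).trans (hFS _ hA), htA⟩
    have hint₁' : ∀ A ∈ F₁, ∀ B ∈ F, B.card ≤ l + 2 → ¬ Disjoint A (B.erase t) := by
      intro A hA B hB hBc hd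
      obtain ⟨htA, hAF⟩ := (mem₁ A).1 hA
      have htB : t ∈ B := by
        by_contra htB
        rw [erase_eq_of_notMem htB] at hd
        exact hint hAF hB (disjoint_insert_left.2 ⟨htB, hd⟩)
      have hc : (A ∪ B).card < S.card := by
        have h1 := card_union_le A B
        have h2 := hk₁ hA
        omega
      obtain ⟨y, hyS, hy⟩ := exists_mem_notMem_of_card_lt_card hc
      have hyA : y ∉ A := fun h => hy (mem_union_left _ h)
      have hyB : y ∉ B := fun h => hy (mem_union_right _ h)
      have hyt : y ≠ t := fun h => hyB (h ▸ htB)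
      have h := hsh _ hAF y hyS t (mem_insert_self t A) (hlt y hyS hyt) (by simp [hyA, hyt])
      rw [erase_insert htA] at h
      refine hint h hB ?_
      rw [disjoint_insert_left]
      refine ⟨hyB, disjoint_left.2 fun x hxA hxB => ?_⟩
      exact disjoint_left.1 hd hxA (mem_erase.2 ⟨fun h => htA (h ▸ hxA), hxB⟩)
    have hint₁ : (F₁ : Set (Finset α)).Intersecting := by
      intro A hA B hB hd
      obtain ⟨htB, hBF⟩ := (mem₁ B).1 hB
      refine hint₁' A hA _ hBF (hk hBF).le ?_
      rwa [erase_insert htB]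
    have hsh₁ : IsShifted e (S.erase t) F₁ := by
      intro A hA i hi j hj hij hiA
      obtain ⟨htA, hAF⟩ := (mem₁ A).1 hA
      have hti : t ≠ i := (ne_of_mem_erase hi).symm
      have htj : t ≠ j := fun h => htA (h ▸ hj)
      rw [mem₁]
      refine ⟨by simp [hti, htA], ?_⟩
      have h := hsh _ hAF i (mem_of_mem_erase hi) j (mem_insert_of_mem hj) hij
        (by simp [hti.symm, hiA])
      rwa [erase_insert_of_ne htj, insert_comm] at h
    obtain ⟨B, hB₀, hoB⟩ : ∃ B ∈ F₀, o ∉ B := by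
      obtain ⟨B, hBF, hoB⟩ := hB
      by_cases htB : t ∈ B
      · have hc : (insert o B).card < S.card := by
          rw [card_insert_of_notMem hoB, hk hBF]
          omega
        obtain ⟨y, hyS, hy⟩ := exists_mem_notMem_of_card_lt_card hc
        have hyo : o ≠ y := fun h => hy (by simp [h])
        have hyB : y ∉ B := fun h => hy (by simp [h])
        have hyt : y ≠ t := fun h => hyB (h ▸ htB)
        refine ⟨_, mem_filter.2 ⟨hsh B hBF y hyS t htB (hlt y hyS hyt) hyB, ?_⟩, ?_⟩
        · simp [hyt.symm]
        · simp [hyo, hoB]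
      · exact ⟨B, mem_filter.2 ⟨hBF, htB⟩, hoB⟩
    obtain ⟨hBF, htB⟩ := mem_filter.1 hB₀
    have hFS₀ : ∀ A ∈ F₀, A ⊆ S.erase t := fun A hA =>
      subset_erase.2 ⟨hFS A (mem_filter.1 hA).1, (mem_filter.1 hA).2⟩
    have hsub₀ : (F₀ : Set (Finset α)) ⊆ F := coe_subset.2 (filter_subset _ _)
    have hsh₀ : IsShifted e (S.erase t) F₀ := by
      intro A hA i hi j hj hij hiA
      obtain ⟨hAF, htA⟩ := mem_filter.1 hA
      refine mem_filter.2 ⟨hsh A hAF i (mem_of_mem_erase hi) j hj hij hiA, ?_⟩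
      simp [(ne_of_mem_erase hi).symm, htA]
    have h₀ := ih (by omega) hS' (hk.mono hsub₀) hFS₀ (hint.mono hsub₀) hsh₀ ho' hmin'
      ⟨B, hB₀, hoB⟩
    have h₁ : F₁.card + (N - (l + 2)).choose l ≤ N.choose l := by
      by_cases hF₁o : ∀ A ∈ F₁, o ∈ A
      · have hFB : ∀ A ∈ F₁, ¬ Disjoint A B := by
          intro A hA
          have := hint₁' A hA B hBF (hk hBF).le
          rwa [erase_eq_of_notMem htB] at this
        have := card_add_choose_le_of_star hS' hk₁ hFS₁ ho' hF₁o (hFS₀ B hB₀) hoB hFB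
        rwa [hk hBF] at this
      · push Not at hF₁o
        obtain _ | r := l
        · obtain ⟨A, hA, hoA⟩ := hF₁o
          exact absurd (mem_of_isShifted_of_sized_one he hk₁ hFS₁ hint₁ hsh₁ ho' hmin' hA) hoA
        have h := ih (by omega) hS' hk₁ hFS₁ hint₁ hsh₁ ho' hmin' hF₁o
        obtain ⟨M, rfl⟩ : ∃ M, N = M + (r + 3) := ⟨N - (r + 3), by omega⟩
        have e1 : M + (r + 3) - 1 - (r + 1) = M + 1 := by omega
        have e2 : M + (r + 3) - (r + 1 + 2) = M := by omega
        rw [e1, Nat.choose_succ_succ'] at h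
        rw [e2]
        have : 0 < M.choose r := Nat.choose_pos (by omega)
        omega
    obtain ⟨M, rfl⟩ : ∃ M, N = M + (l + 2) := ⟨N - (l + 2), by omega⟩
    have e1 : M + (l + 2) + 1 - 1 - (l + 1) = M + 1 := by omega
    have e2 : M + (l + 2) - 1 - (l + 1) = M := by omega
    have e3 : M + (l + 2) - (l + 2) = M := by omega
    rw [e2] at h₀
    rw [e3] at h₁
    rw [e1, Nat.choose_succ_succ' M, Nat.choose_succ_succ' (M + (l + 2)), hcard]
    omega

/-- An intersecting family of `k`-sets without a common element. -/
structure IsNontrivialIntersecting (k : ℕ) (F : Finset (Finset α)) : Prop where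
  sized : (F : Set (Finset α)).Sized k
  intersecting : (F : Set (Finset α)).Intersecting
  exists_notMem : ∀ x, ∃ A ∈ F, x ∉ A

lemma isShifted_of_shiftSet_mem {e : α → ℕ} {S : Finset α}
    (h : ∀ i j, e i < e j → ∀ A ∈ F, shiftSet i j A ∈ F) : IsShifted e S F := by
  intro A hA i _ j hj hij hi
  have := h i j hij A hA
  rwa [shiftSet, if_pos ⟨hj, hi⟩] at this

lemma mem_shiftIn_iff_of_ne {i j x : α} {A : Finset α} (hi : x ≠ i) (hj : x ≠ j) :
    x ∈ shiftIn F i j A ↔ x ∈ A := by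
  unfold shiftIn shiftSet
  split_ifs <;> simp [hi, hj]

/-- If the shift of a nontrivial intersecting family has a common element, then all members of
the family meet the pair of shifted points. -/
lemma mem_or_mem_of_shiftFamily_trivial {i j x : α} (hF : ∀ y, ∃ A ∈ F, y ∉ A)
    (hx : ∀ A ∈ shiftFamily F i j, x ∈ A) {A : Finset α} (hA : A ∈ F) : i ∈ A ∨ j ∈ A := by
  have hx' : ∀ B ∈ F, x ∈ shiftIn F i j B := fun B hB => hx _ (mem_image_of_mem _ hB)
  have hxi : x = i := by
    by_contra hxi
    obtain ⟨B, hB, hxB⟩ := hF x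
    have := hx' B hB
    unfold shiftIn shiftSet at this
    grind
  subst hxi
  have := hx' A hA
  unfold shiftIn shiftSet at this
  grind

lemma exists_initial_of_shiftSet_mem {e : α → ℕ} {p q : α}
    (hs : ∀ a b, a ≠ q → b ≠ p → e a < e b → ∀ A ∈ F, p ∈ A → q ∉ A → shiftSet a b A ∈ F)
    (hF : ∃ A ∈ F, p ∈ A ∧ q ∉ A) :
    ∃ A ∈ F, p ∈ A ∧ q ∉ A ∧ ∀ b ∈ A, b ≠ p → ∀ a ∉ A, a ≠ q → e b ≤ e a := by
  obtain ⟨A₀, hA₀⟩ := hF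
  obtain ⟨A, hA, hmin⟩ := exists_min_image (F.filter fun A => p ∈ A ∧ q ∉ A)
    (fun A => ∑ x ∈ A, e x) ⟨A₀, mem_filter.2 hA₀⟩
  obtain ⟨hAF, hp, hq⟩ := mem_filter.1 hA
  refine ⟨A, hAF, hp, hq, fun b hb hbp a ha haq => ?_⟩
  by_contra! hab
  have hmem := hs a b haq hbp hab A hAF hp hq
  have hne : shiftSet a b A ≠ A := by
    rw [shiftSet, if_pos ⟨hb, ha⟩]
    exact fun h => ha (h ▸ mem_insert_self _ _)
  refine (sum_shiftSet_lt hab hne).not_ge (hmin _ (mem_filter.2 ⟨hmem, ?_⟩))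
  rw [shiftSet, if_pos ⟨hb, ha⟩]
  simp [hp, hq, hbp.symm, haq.symm]

variable [Fintype α]

lemma exists_isShifted_of_powersetCard_subset {T : Finset α} (hF : IsNontrivialIntersecting k F)
    (hT : T.card = k + 1) (hTF : powersetCard k T ⊆ F) :
    ∃ e : α → ℕ, e.Injective ∧ ∃ G, IsNontrivialIntersecting k G ∧ G.card = F.card ∧
      IsShifted e univ G := by
  let e₀ := Fintype.equivFin α
  let e : α → ℕ := fun x => if x ∈ T then e₀ x else e₀ x + Fintype.card α
  have he : e.Injective := by
    intro x y h
    have hx := (e₀ x).isLt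
    have hy := (e₀ y).isLt
    apply e₀.injective
    ext
    simp only [e] at h
    split_ifs at h <;> omega
  have heT : ∀ x y, e x < e y → y ∈ T → x ∈ T := by
    intro x y h hy
    have := (e₀ y).isLt
    by_contra hx
    simp only [e, hx, hy, if_true, if_false] at h
    omega
  obtain ⟨G, ⟨hG, hTG⟩, hc, hs⟩ := exists_stable
    (fun G => IsNontrivialIntersecting k G ∧ powersetCard k T ⊆ G) (fun i j => e i < e j) e
    (fun _ _ h => h) ⟨hF, hTF⟩
  refine ⟨e, he, G, hG, hc, isShifted_of_shiftSet_mem fun i j hij => hs i j hij ?_⟩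
  have hsub : powersetCard k T ⊆ shiftFamily G i j := by
    intro A hA
    refine mem_shiftFamily_of_shiftSet_mem (hTG hA) (hTG ?_)
    rw [mem_powersetCard] at hA ⊢
    rw [card_shiftSet]
    refine ⟨?_, hA.2⟩
    unfold shiftSet
    split_ifs with h
    · exact insert_subset (heT i j hij (hA.1 h.1)) ((erase_subset _ _).trans hA.1)
    · exact hA.1
  refine ⟨⟨sized_shiftFamily hG.sized, intersecting_shiftFamily hG.intersecting, fun x => ?_⟩,
    hsub⟩
  have hle : k ≤ (T.erase x).card := by
    have := pred_card_le_card_erase (s := T) (a := x)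
    omega
  obtain ⟨A, hAT, hA⟩ := exists_subset_card_eq hle
  exact ⟨A, hsub (mem_powersetCard.2 ⟨hAT.trans (erase_subset _ _), hA⟩),
    fun h => notMem_erase x T (hAT h)⟩

lemma exists_powersetCard_subset {i j : α} (hij : i ≠ j) (h2 : 2 ≤ k)
    (hα : k + 1 ≤ Fintype.card α) (hF : IsNontrivialIntersecting k F)
    (hFij : ∀ A ∈ F, i ∈ A ∨ j ∈ A) :
    ∃ G, IsNontrivialIntersecting k G ∧ F.card ≤ G.card ∧
      ∃ T : Finset α, T.card = k + 1 ∧ powersetCard k T ⊆ G := by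
  let Q : Finset (Finset α) → Prop := fun H => IsNontrivialIntersecting k H ∧
    (∀ A ∈ H, i ∈ A ∨ j ∈ A) ∧ ∀ A : Finset α, A.card = k → i ∈ A → j ∈ A → A ∈ H
  let F' := F ∪ univ.filter fun A : Finset α => A.card = k ∧ i ∈ A ∧ j ∈ A
  have hF'ij : ∀ A ∈ F', i ∈ A ∨ j ∈ A := by
    intro A hA
    rcases mem_union.1 hA with hA | hA
    · exact hFij A hA
    · exact Or.inl (mem_filter.1 hA).2.2.1
  have hQ : Q F' := by
    refine ⟨⟨?_, ?_, ?_⟩, hF'ij, ?_⟩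
    · intro A hA
      rcases mem_union.1 hA with hA | hA
      · exact hF.sized hA
      · exact (mem_filter.1 hA).2.1
    · intro A hA B hB hd
      rw [disjoint_left] at hd
      rcases mem_union.1 hA with hA' | hA'
      · rcases mem_union.1 hB with hB' | hB'
        · exact hF.intersecting hA' hB' (disjoint_left.2 hd)
        · obtain ⟨-, hi, hj⟩ := (mem_filter.1 hB').2
          rcases hFij A hA' with h | h
          exacts [hd h hi, hd h hj]
      · obtain ⟨-, hi, hj⟩ := (mem_filter.1 hA').2
        rcases hF'ij B hB with h | h
        exacts [hd hi h, hd hj h]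
    · intro x
      obtain ⟨A, hA, hxA⟩ := hF.exists_notMem x
      exact ⟨A, mem_union_left _ hA, hxA⟩
    · intro A hA hi hj
      exact mem_union_right _ (mem_filter.2 ⟨mem_univ A, hA, hi, hj⟩)
  let e : α → ℕ := fun x => Fintype.equivFin α x
  have he : e.Injective := fun x y h => (Fintype.equivFin α).injective (Fin.ext h)
  obtain ⟨G, ⟨hG, hGij, hGmem⟩, hc, hs⟩ := exists_stable Q
    (fun a b => e a < e b ∧ (i ≠ a ∧ i ≠ b) ∧ j ≠ a ∧ j ≠ b) e (fun _ _ h => h.1) hQ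
  have hstab : ∀ a b, e a < e b → i ≠ a → i ≠ b → j ≠ a → j ≠ b →
      ∀ A ∈ G, shiftSet a b A ∈ G := by
    intro a b hab hia hib hja hjb
    have hmem : ∀ A : Finset α, A.card = k → i ∈ A → j ∈ A → A ∈ shiftFamily G a b := by
      intro A hA hi hj
      refine mem_shiftFamily_of_shiftSet_mem (hGmem A hA hi hj)
        (hGmem _ (card_shiftSet.trans hA) ?_ ?_)
      · unfold shiftSet
        split_ifs <;> simp [hi, hib]
      · unfold shiftSet
        split_ifs <;> simp [hj, hjb]
    refine hs a b ⟨hab, ⟨hia, hib⟩, hja, hjb⟩ ⟨⟨sized_shiftFamily hG.sized,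
      intersecting_shiftFamily hG.intersecting, fun x => ?_⟩, ?_, hmem⟩
    · by_cases hx : x = i ∨ x = j
      · obtain ⟨A, hA, hxA⟩ := hG.exists_notMem x
        refine ⟨_, mem_image_of_mem _ hA, ?_⟩
        rcases hx with rfl | rfl
        · rwa [mem_shiftIn_iff_of_ne hia hib]
        · rwa [mem_shiftIn_iff_of_ne hja hjb]
      · push Not at hx
        have hsub : {i, j} ⊆ univ.erase x := by
          intro y hy
          simp only [mem_insert, mem_singleton] at hy
          rcases hy with rfl | rfl
          · simp [hx.1.symm]
          · simp [hx.2.symm]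
        have hcx : k ≤ (univ.erase x).card := by
          rw [card_erase_of_mem (mem_univ x), card_univ]
          omega
        obtain ⟨A, hA, hAx, hAc⟩ :=
          exists_subsuperset_card_eq hsub ((card_pair hij).trans_le h2) hcx
        exact ⟨A, hmem A hAc (hA (by simp)) (hA (by simp)), fun h => notMem_erase x _ (hAx h)⟩
    · intro A hA
      obtain ⟨B, hB, rfl⟩ := mem_image.1 hA
      rw [mem_shiftIn_iff_of_ne hia hib, mem_shiftIn_iff_of_ne hja hjb]
      exact hGij B hB
  have hshift : ∀ p q, (p = i ∧ q = j ∨ p = j ∧ q = i) → ∀ a b, a ≠ q → b ≠ p → e a < e b →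
      ∀ A ∈ G, p ∈ A → q ∉ A → shiftSet a b A ∈ G := by
    intro p q hpq a b haq hbp hab A hA hp hq
    by_cases h : b ∈ A ∧ a ∉ A
    · have hap : a ≠ p := fun h' => h.2 (h' ▸ hp)
      have hbq : b ≠ q := fun h' => hq (h' ▸ h.1)
      rcases hpq with ⟨rfl, rfl⟩ | ⟨rfl, rfl⟩
      · exact hstab a b hab hap.symm hbp.symm haq.symm hbq.symm A hA
      · exact hstab a b hab haq.symm hbq.symm hap.symm hbp.symm A hA
    · rwa [shiftSet, if_neg h]
  obtain ⟨A, hA, hiA, hjA, hAmin⟩ : ∃ A ∈ G, i ∈ A ∧ j ∉ A ∧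
      ∀ b ∈ A, b ≠ i → ∀ a ∉ A, a ≠ j → e b ≤ e a := by
    refine exists_initial_of_shiftSet_mem (hshift i j (by simp)) ?_
    obtain ⟨A, hA, hjA⟩ := hG.exists_notMem j
    exact ⟨A, hA, (hGij A hA).resolve_right hjA, hjA⟩
  obtain ⟨B, hB, hjB, hiB, hBmin⟩ : ∃ B ∈ G, j ∈ B ∧ i ∉ B ∧
      ∀ b ∈ B, b ≠ j → ∀ a ∉ B, a ≠ i → e b ≤ e a := by
    refine exists_initial_of_shiftSet_mem (hshift j i (by simp)) ?_
    obtain ⟨B, hB, hiB⟩ := hG.exists_notMem i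
    exact ⟨B, hB, (hGij B hB).resolve_left hiB, hiB⟩
  have hAc : A.card = k := hG.sized hA
  have hBc : B.card = k := hG.sized hB
  have hc' : (A.erase i).card = (B.erase j).card := by
    rw [card_erase_of_mem hiA, card_erase_of_mem hjB, hAc, hBc]
  have hAB : B.erase j = A.erase i := by
    refine eq_of_subset_of_card_le (fun y hy => ?_) hc'.le
    by_contra hyA
    obtain ⟨x, hxA, hxB⟩ : ∃ x ∈ A.erase i, x ∉ B.erase j := by
      by_contra! hsub
      exact hyA (eq_of_subset_of_card_le hsub hc'.ge ▸ hy)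
    rw [mem_erase] at hxA hy
    have hxj : x ≠ j := fun h => hjA (h ▸ hxA.2)
    have hyi : y ≠ i := fun h => hiB (h ▸ hy.2)
    have hxB' : x ∉ B := fun h => hxB (mem_erase.2 ⟨hxj, h⟩)
    have hyA' : y ∉ A := fun h => hyA (mem_erase.2 ⟨hyi, h⟩)
    have hxy := (hAmin x hxA.2 hxA.1 y hyA' hy.1).antisymm (hBmin y hy.2 hy.1 x hxB' hxA.1)
    exact hyA' (he hxy ▸ hxA.2)
  refine ⟨G, hG, hc ▸ card_le_card subset_union_left, insert j A, ?_, fun X hX => ?_⟩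
  · rw [card_insert_of_notMem hjA, hAc]
  · obtain ⟨hXT, hXc⟩ := mem_powersetCard.1 hX
    by_cases hjX : j ∈ X
    · by_cases hiX : i ∈ X
      · exact hGmem X hXc hiX hjX
      · have : X ⊆ B := by
          rw [← insert_erase hjB, hAB, ← erase_insert_of_ne hij.symm]
          exact subset_erase.2 ⟨hXT, hiX⟩
        rwa [eq_of_subset_of_card_le this (by omega)]
    · have : X ⊆ A := by
        rw [← erase_insert hjA]
        exact subset_erase.2 ⟨hXT, hjX⟩
      rwa [eq_of_subset_of_card_le this (by omega)]

lemma exists_isShifted (h2 : 2 ≤ k) (hα : k + 1 ≤ Fintype.card α)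
    (hF : IsNontrivialIntersecting k F) :
    ∃ e : α → ℕ, e.Injective ∧ ∃ G, IsNontrivialIntersecting k G ∧ F.card ≤ G.card ∧
      IsShifted e univ G := by
  let e : α → ℕ := fun x => Fintype.equivFin α x
  have he : e.Injective := fun x y h => (Fintype.equivFin α).injective (Fin.ext h)
  obtain ⟨G, hG, hc, hs⟩ := exists_stable (IsNontrivialIntersecting k) (fun i j => e i < e j) e
    (fun _ _ h => h) hF
  by_cases h : ∀ i j, e i < e j → ∀ A ∈ G, shiftSet i j A ∈ G
  · exact ⟨e, he, G, hG, hc.ge, isShifted_of_shiftSet_mem h⟩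
  push Not at h
  obtain ⟨i, j, hij, A, hA, hA'⟩ := h
  have hne : i ≠ j := fun h => hij.ne (congrArg e h)
  have htriv : ∃ x, ∀ A ∈ shiftFamily G i j, x ∈ A := by
    by_contra! hx
    exact hA' (hs i j hij
      ⟨sized_shiftFamily hG.sized, intersecting_shiftFamily hG.intersecting, hx⟩ A hA)
  obtain ⟨x, hx⟩ := htriv
  obtain ⟨H, hH, hGH, T, hT, hTH⟩ := exists_powersetCard_subset hne h2 hα hG
    fun A hA => mem_or_mem_of_shiftFamily_trivial hG.exists_notMem hx hA
  obtain ⟨e', he', H', hH', hc', hstab⟩ := exists_isShifted_of_powersetCard_subset hH hT hTH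
  exact ⟨e', he', H', hH', by omega, hstab⟩

/-- The **Hilton–Milner theorem**. -/
theorem card_add_choose_le_of_isNontrivialIntersecting {N : ℕ} (hα : Fintype.card α = N + 1)
    (hk : 1 ≤ k) (hN : 2 * k + 1 ≤ N) (hF : IsNontrivialIntersecting (k + 1) F) :
    F.card + (N - 1 - k).choose k ≤ N.choose k + 1 := by
  obtain ⟨e, he, G, hG, hc, hs⟩ := exists_isShifted (by omega) (by omega) hF
  have hne : (univ : Finset α).Nonempty := by
    rw [← card_pos, card_univ]
    omega
  obtain ⟨o, ho, hmin⟩ := exists_min_image univ e hne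
  have := card_add_choose_le_of_isShifted he hN (card_univ.trans hα) hG.sized
    (fun A _ => subset_univ A) hG.intersecting hs ho hmin (hG.exists_notMem o)
  omega

variable {r : ℕ}

open scoped FinsetFamily

lemma card_mul_le_card_upShadow_mul (hF : (F : Set (Finset α)).Sized r) :
    F.card * (Fintype.card α - r) ≤ (∂⁺ F).card * (r + 1) := by
  refine card_mul_le_card_mul (· ⊆ ·) (fun A hA => ?_) (fun B hB => ?_)
  · rw [← hF hA, ← card_compl, ← card_image_of_injOn (insert_inj_on' A)]
    refine card_le_card fun B hB => ?_
    obtain ⟨x, hx, rfl⟩ := mem_image.1 hB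
    exact mem_filter.2 ⟨insert_mem_upShadow hA (mem_compl.1 hx), subset_insert x A⟩
  · rw [← hF.upShadow hB]
    refine (card_le_card fun A hA => ?_).trans (card_image_le (s := B) (f := B.erase))
    obtain ⟨hA, hAB⟩ := mem_filter.1 hA
    have hc : (B \ A).card = 1 := by
      rw [card_sdiff_of_subset hAB, hF.upShadow hB, hF hA]
      omega
    obtain ⟨x, hx⟩ := card_eq_one.1 hc
    have hxB : x ∈ B := (mem_sdiff.1 (hx ▸ mem_singleton_self x)).1
    exact mem_image.2 ⟨x, hxB, by rw [erase_eq, ← hx, sdiff_sdiff_eq_self hAB]⟩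

lemma card_le_card_upShadow (hF : (F : Set (Finset α)).Sized r)
    (hr : 2 * (r + 1) ≤ Fintype.card α) :
    F.card ≤ (∂⁺ F).card ∧ (F.Nonempty → F.card < (∂⁺ F).card) := by
  have h := card_mul_le_card_upShadow_mul hF
  have h' : F.card * (r + 2) ≤ (∂⁺ F).card * (r + 1) :=
    (Nat.mul_le_mul_left _ (by omega)).trans h
  have hlt : F.Nonempty → F.card < (∂⁺ F).card := by
    intro hne
    have := hne.card_pos
    by_contra! hle
    nlinarith
  refine ⟨?_, hlt⟩
  rcases F.eq_empty_or_nonempty with rfl | hne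
  · simp
  · exact (hlt hne).le

/-- An intersecting antichain of sets of size at most `k` can be replaced by an intersecting
family of `k`-sets, by repeatedly replacing the smallest sets by their upper shadow. -/
lemma exists_sized_of_isAntichain (hα : 2 * k ≤ Fintype.card α)
    (hF : IsAntichain (· ⊆ ·) (F : Set (Finset α))) (hint : (F : Set (Finset α)).Intersecting)
    (hk : ∀ A ∈ F, A.card ≤ k) :
    ∃ G : Finset (Finset α), (G : Set (Finset α)).Sized k ∧ (G : Set (Finset α)).Intersecting ∧
      F.card ≤ G.card ∧ ((∃ A ∈ F, A.card < k) → F.card < G.card) ∧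
      ((∀ x, ∃ A ∈ F, x ∉ A) → ∀ x, ∃ A ∈ G, x ∉ A) := by
  obtain ⟨d, hd⟩ : ∃ d, ∀ A ∈ F, k ≤ A.card + d := ⟨k, fun A _ => Nat.le_add_left k A.card⟩
  induction d generalizing F with
  | zero =>
    refine ⟨F, fun A hA => (hk A hA).antisymm (hd A hA), hint, le_rfl, ?_, id⟩
    rintro ⟨A, hA, hlt⟩
    have := hd A hA
    omega
  | succ d ih =>
    set L := F.filter fun A => A.card + (d + 1) = k with hL
    set U := F.filter fun A => ¬ A.card + (d + 1) = k with hU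
    have hLF : ∀ A ∈ L, A ∈ F := fun A hA => (mem_filter.1 hA).1
    have hUF : ∀ A ∈ U, A ∈ F := fun A hA => (mem_filter.1 hA).1
    have hLU : L.card + U.card = F.card := card_filter_add_card_filter_not _
    have hLs : (L : Set (Finset α)).Sized (k - (d + 1)) := by
      intro A hA
      have := (mem_filter.1 hA).2
      omega
    have hSs : ∀ B ∈ ∂⁺ L, B.card + d = k := by
      intro B hB
      obtain ⟨A, hA, x, hx, rfl⟩ := mem_upShadow_iff.1 hB
      have := (mem_filter.1 hA).2
      rw [card_insert_of_notMem hx]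
      omega
    have hUs : ∀ B ∈ U, k ≤ B.card + d := by
      intro B hB
      have := hd B (hUF B hB)
      have := (mem_filter.1 hB).2
      omega
    have hshadow : L.card ≤ (∂⁺ L).card ∧ (L.Nonempty → L.card < (∂⁺ L).card) := by
      rcases L.eq_empty_or_nonempty with h | ⟨A, hA⟩
      · simp [h]
      · have := (mem_filter.1 hA).2
        exact card_le_card_upShadow hLs (by omega)
    have hne : ∀ B ∈ ∂⁺ L, ∀ C ∈ U, ¬ B ⊆ C := by
      intro B hB C hC hBC
      obtain ⟨A, hA, hAB⟩ := exists_subset_of_mem_upShadow hB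
      refine hF (hLF A hA) (hUF C hC) ?_ (hAB.trans hBC)
      rintro rfl
      exact (mem_filter.1 hC).2 (mem_filter.1 hA).2
    have hdisj : Disjoint U (∂⁺ L) :=
      disjoint_left.2 fun B hU hS => hne B hS B hU Subset.rfl
    have hcard : (U ∪ ∂⁺ L).card = U.card + (∂⁺ L).card := card_union_of_disjoint hdisj
    have hsup : ∀ B ∈ U ∪ ∂⁺ L, ∃ A ∈ F, A ⊆ B := by
      intro B hB
      rcases mem_union.1 hB with hB | hB
      · exact ⟨B, hUF B hB, Subset.rfl⟩
      · obtain ⟨A, hA, hAB⟩ := exists_subset_of_mem_upShadow hB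
        exact ⟨A, hLF A hA, hAB⟩
    have hanti : IsAntichain (· ⊆ ·) ((U ∪ ∂⁺ L : Finset (Finset α)) : Set (Finset α)) := by
      intro B hB C hC hBC hsub
      have hlt : B.card < C.card := card_lt_card (hsub.ssubset_of_ne hBC)
      rcases mem_union.1 hB with hB | hB <;> rcases mem_union.1 hC with hC | hC
      · exact hF (hUF B hB) (hUF C hC) hBC hsub
      · have := hUs B hB
        have := hSs C hC
        omega
      · exact hne B hB C hC hsub
      · have := hSs B hB
        have := hSs C hC
        omega
    have hint' : ((U ∪ ∂⁺ L : Finset (Finset α)) : Set (Finset α)).Intersecting := by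
      intro B hB C hC hdj
      obtain ⟨B', hB', hBB⟩ := hsup B hB
      obtain ⟨C', hC', hCC⟩ := hsup C hC
      exact hint hB' hC' (hdj.mono hBB hCC)
    have hk' : ∀ B ∈ U ∪ ∂⁺ L, B.card ≤ k := by
      intro B hB
      rcases mem_union.1 hB with hB | hB
      · exact hk B (hUF B hB)
      · have := hSs B hB
        omega
    have hd' : ∀ B ∈ U ∪ ∂⁺ L, k ≤ B.card + d := by
      intro B hB
      rcases mem_union.1 hB with hB | hB
      · exact hUs B hB
      · exact (hSs B hB).ge
    have htriv : (∀ x, ∃ A ∈ F, x ∉ A) → ∀ x, ∃ A ∈ U ∪ ∂⁺ L, x ∉ A := by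
      intro h x
      obtain ⟨A, hA, hxA⟩ := h x
      by_cases hAk : A.card + (d + 1) = k
      · have hc : (insert x A).card < (univ : Finset α).card := by
          rw [card_insert_of_notMem hxA, card_univ]
          omega
        obtain ⟨y, -, hy⟩ := exists_mem_notMem_of_card_lt_card hc
        rw [mem_insert, not_or] at hy
        refine ⟨insert y A, mem_union_right _
          (insert_mem_upShadow (mem_filter.2 ⟨hA, hAk⟩) hy.2), ?_⟩
        simp [Ne.symm hy.1, hxA]
      · exact ⟨A, mem_union_left _ (mem_filter.2 ⟨hA, hAk⟩), hxA⟩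
    obtain ⟨G, hGs, hGi, hGc, hGlt, hGt⟩ := ih hanti hint' hk' hd'
    refine ⟨G, hGs, hGi, by omega, ?_, fun h => hGt (htriv h)⟩
    rintro ⟨A, hA, hAlt⟩
    by_cases hAk : A.card + (d + 1) = k
    · have := hshadow.2 ⟨A, mem_filter.2 ⟨hA, hAk⟩⟩
      omega
    · have := hGlt ⟨A, mem_union_left _ (mem_filter.2 ⟨hA, hAk⟩), hAlt⟩
      omega

end Finset

lemma Nat.le_choose_of_pos_of_lt {n j : ℕ} (hj : 0 < j) (hjn : j < n) : n ≤ n.choose j := by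
  induction n generalizing j with
  | zero => omega
  | succ n ih =>
    obtain ⟨i, rfl⟩ : ∃ i, j = i + 1 := ⟨j - 1, by omega⟩
    rw [Nat.choose_succ_succ']
    rcases (Nat.lt_succ_iff.1 hjn).eq_or_lt with rfl | h
    · rw [Nat.choose_succ_self_right, Nat.choose_self]
    · have := ih hj h
      have : 0 < n.choose i := Nat.choose_pos (by omega)
      omega

lemma exists_row {m n : ℕ} {C : Fin m → Fin n → Fin 2} (hC : IsCoveringArray m n 2 2 C)
    {i j : Fin n} (hij : i ≠ j) (a b : Fin 2) : ∃ r, C r i = a ∧ C r j = b := by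
  have hinj : Function.Injective ![i, j] := by
    intro x y h
    fin_cases x <;> fin_cases y <;> simp_all
  obtain ⟨r, hr⟩ := hC ![i, j] hinj ![a, b]
  exact ⟨r, hr 0, hr 1⟩

lemma mem_colSupp {m n : ℕ} {C : Fin m → Fin n → Fin 2} {i : Fin n} {r : Fin m} :
    r ∈ colSupp C i ↔ C r i = 1 := by
  simp only [colSupp, Finset.mem_filter, Finset.mem_univ, true_and]
  omega

/-- The supports of the columns of a binary `2`-covering array with at least two columns form an
intersecting antichain. -/
lemma exists_sized_of_isCoveringArray {m n k : ℕ} {C : Fin m → Fin n → Fin 2} (hn : 2 ≤ n)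
    (hm : 2 * k ≤ m) (hC : IsCoveringArray m n 2 2 C) (hwt : ∀ i, colWt C i ≤ k)
    (hint : ¬ ∃ r, ∀ i, r ∈ colSupp C i) :
    ∃ G : Finset (Finset (Fin m)), Finset.IsNontrivialIntersecting k G ∧ n ≤ G.card ∧
      ((∃ i, colWt C i < k) → n < G.card) := by
  have hsub : ∀ i j, i ≠ j → ¬ colSupp C i ⊆ colSupp C j := by
    intro i j hij h
    obtain ⟨r, hi, hj⟩ := exists_row hC hij 1 0
    have := mem_colSupp.1 (h (mem_colSupp.2 hi))
    simp [hj] at this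
  have hinj : Function.Injective (colSupp C) := fun i j h =>
    by_contra fun hij => hsub i j hij h.le
  have hmeet : ∀ i j, i ≠ j → ¬ Disjoint (colSupp C i) (colSupp C j) := by
    intro i j hij h
    obtain ⟨r, hi, hj⟩ := exists_row hC hij 1 1
    exact Finset.disjoint_left.1 h (mem_colSupp.2 hi) (mem_colSupp.2 hj)
  have : Nontrivial (Fin n) := Fin.nontrivial_iff_two_le.2 hn
  have hcard : (Finset.univ.image (colSupp C)).card = n := by
    rw [Finset.card_image_of_injective _ hinj, Finset.card_univ, Fintype.card_fin]
  set F := Finset.univ.image (colSupp C) with hF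
  have mem_F : ∀ A ∈ (F : Set (Finset (Fin m))), ∃ i, colSupp C i = A := by simp [hF]
  have hanti : IsAntichain (· ⊆ ·) (F : Set (Finset (Fin m))) := by
    intro A hA B hB hAB
    obtain ⟨i, rfl⟩ := mem_F A hA
    obtain ⟨j, rfl⟩ := mem_F B hB
    exact hsub i j fun h => hAB (congrArg _ h)
  have hinter : (F : Set (Finset (Fin m))).Intersecting := by
    intro A hA B hB
    obtain ⟨i, rfl⟩ := mem_F A hA
    obtain ⟨j, rfl⟩ := mem_F B hB
    rcases eq_or_ne i j with rfl | hij
    · obtain ⟨l, hl⟩ := exists_ne i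
      intro h
      rw [disjoint_self] at h
      exact hmeet i l hl.symm (h ▸ disjoint_bot_left)
    · exact hmeet i j hij
  have hle : ∀ A ∈ F, A.card ≤ k := by
    intro A hA
    obtain ⟨i, rfl⟩ := mem_F A hA
    exact hwt i
  obtain ⟨G, hGs, hGi, hGc, hGlt, hGt⟩ :=
    Finset.exists_sized_of_isAntichain (by rwa [Fintype.card_fin]) hanti hinter hle
  have hmem : ∀ i, colSupp C i ∈ F := fun i => Finset.mem_image_of_mem _ (Finset.mem_univ i)
  rw [hcard] at hGc hGlt
  refine ⟨G, ⟨hGs, hGi, hGt fun r => ?_⟩, hGc, fun ⟨i, hi⟩ => hGlt ⟨_, hmem i, hi⟩⟩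
  push Not at hint
  obtain ⟨i, hi⟩ := hint r
  exact ⟨_, hmem i, hi⟩

/-- Hilton–Milner corollary: if all columns of an `m × n` binary 2-covering
array have weight at most `⌊m/2⌋` and the supports of all columns have empty intersection,
then `n ≤ binom(m-1, ⌊m/2⌋-1)` for `m` even and `n ≤ binom(m-1, ⌊m/2⌋-1) - ⌊m/2⌋ + 1` for
`m` odd, with strict inequality if some column has weight `< ⌊m/2⌋`. -/
theorem hilton_milner_covering (m n : ℕ) (hm : 4 ≤ m) (C : Fin m → Fin n → Fin 2)
    (hC : IsCoveringArray m n 2 2 C)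
    (hwt : ∀ i : Fin n, colWt C i ≤ m / 2)
    (hint : ¬ ∃ r : Fin m, ∀ i : Fin n, r ∈ colSupp C i) :
    ((Even m → n ≤ (m-1).choose (m/2 - 1)) ∧
     (Odd m → n ≤ (m-1).choose (m/2 - 1) - m/2 + 1)) ∧
    ((∃ i : Fin n, colWt C i < m / 2) →
     (Even m → n < (m-1).choose (m/2 - 1)) ∧
     (Odd m → n < (m-1).choose (m/2 - 1) - m/2 + 1)) := by
  have hbig : m - 1 ≤ (m - 1).choose (m / 2 - 1) :=
    Nat.le_choose_of_pos_of_lt (by omega) (by omega)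
  rcases lt_or_ge n 2 with hn | hn
  · refine ⟨⟨fun _ => ?_, fun _ => ?_⟩, fun _ => ⟨fun _ => ?_, fun _ => ?_⟩⟩ <;> omega
  obtain ⟨G, hG, hle, hlt⟩ := exists_sized_of_isCoveringArray hn (by omega) hC hwt hint
  obtain ⟨k, hk⟩ : ∃ k, m / 2 = k + 1 := ⟨m / 2 - 1, by omega⟩
  rw [hk] at hG hlt hbig ⊢
  have heven : Even m → G.card ≤ (m - 1).choose k := by
    rintro ⟨l, hl⟩
    have h := Finset.card_le_choose_of_intersecting (k := k) (S := Finset.univ)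
      (by rw [Finset.card_univ, Fintype.card_fin]; omega) hG.sized
      (fun A _ => Finset.subset_univ A) hG.intersecting
    rwa [show m - 1 = 2 * k + 1 by omega]
  have hodd : Odd m → G.card + (k + 1) ≤ (m - 1).choose k + 1 := by
    rintro ⟨l, hl⟩
    have h := Finset.card_add_choose_le_of_isNontrivialIntersecting (N := m - 1)
      (by rw [Fintype.card_fin]; omega) (by omega) (by omega) hG
    rwa [show m - 1 - 1 - k = k + 1 by omega, Nat.choose_succ_self_right] at h
  rw [Nat.add_sub_cancel] at hbig ⊢
  refine ⟨⟨fun h => ?_, fun h => ?_⟩, fun hw => ⟨fun h => ?_, fun h => ?_⟩⟩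
  · exact hle.trans (heven h)
  · have := hodd h
    omega
  · exact (hlt hw).trans_le (heven h)
  · have := hodd h
    have := hlt hw
    omega
end

section
/- Let m ≥ 4 and let C be an m×n binary 2-covering array with n > binom(m−1, ⌊m/2⌋−1) + m − 3⌊m/2⌋. Then C is equivalent to a matrix obtained by deleting columns from the standard maximal binary 2-covering array of size m. Moreover, every column c^i of C satisfies: wt(c^i) = ⌊m/2⌋ if m is even, and wt(c^i) ∈ {⌊m/2⌋, ⌊m/2⌋+1} if m is odd. -/
namespace NearMaximal

open Finset Finset.Colex
open scoped FinsetFamily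

section Shadow

variable {α : Type*} [DecidableEq α]

/-- A form of the local LYM inequality relative to a subset `V` of the ground set: the shadow of a
family of `r`-subsets of `V` is not smaller than the family when `r` exceeds `#V / 2`. -/
lemma card_le_card_shadow {V : Finset α} {r : ℕ} {𝒟 : Finset (Finset α)}
    (h𝒟 : 𝒟 ⊆ powersetCard r V) (hV : #V + 1 ≤ 2 * r) : #𝒟 ≤ #(∂ 𝒟) := by
  have hr : 0 < r := by omega
  refine Nat.le_of_mul_le_mul_right ?_ hr
  refine card_mul_le_card_mul (fun A B ↦ B ⊆ A) (fun A hA ↦ ?_) fun B hB ↦ ?_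
  · rw [← (mem_powersetCard.1 (h𝒟 hA)).2, ← card_image_of_injOn A.erase_injOn]
    refine card_le_card fun B hB ↦ ?_
    obtain ⟨a, ha, rfl⟩ := mem_image.1 hB
    exact (mem_bipartiteAbove _).2 ⟨erase_mem_shadow hA ha, erase_subset _ _⟩
  · have hsized : (𝒟 : Set (Finset α)).Sized r := fun A hA ↦ (mem_powersetCard.1 (h𝒟 hA)).2
    have hBr : #B = r - 1 := hsized.shadow hB
    obtain ⟨A, hA, hBA⟩ := exists_subset_of_mem_shadow hB
    have hBV : B ⊆ V := hBA.trans (mem_powersetCard.1 (h𝒟 hA)).1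
    have hsub : 𝒟.bipartiteBelow (fun A B ↦ B ⊆ A) B ⊆ (V \ B).image fun a ↦ insert a B := by
      intro A hA
      obtain ⟨hA, hBA⟩ := (mem_bipartiteBelow _).1 hA
      obtain ⟨hAV, hAr⟩ := mem_powersetCard.1 (h𝒟 hA)
      have hcard : #(A \ B) = 1 := by rw [card_sdiff_of_subset hBA]; omega
      obtain ⟨a, ha⟩ := card_eq_one.1 hcard
      have haA : a ∈ A \ B := by simp [ha]
      refine mem_image.2 ⟨a, mem_sdiff.2 ⟨hAV (mem_sdiff.1 haA).1, (mem_sdiff.1 haA).2⟩, ?_⟩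
      rw [insert_eq, ← ha, sdiff_union_of_subset hBA]
    refine (card_le_card hsub).trans (card_image_le.trans ?_)
    rw [card_sdiff_of_subset hBV]
    omega

lemma shadow_memberSubfamily_subset (x : α) (𝒟 : Finset (Finset α)) :
    ∂ (𝒟.memberSubfamily x) ⊆ (∂ 𝒟).memberSubfamily x := by
  intro B hB
  rw [mem_shadow_iff_insert_mem] at hB
  obtain ⟨a, haB, ha⟩ := hB
  rw [mem_memberSubfamily] at ha ⊢
  rw [mem_shadow_iff_insert_mem]
  refine ⟨⟨a, ?_, by rw [insert_comm]; exact ha.1⟩, fun h ↦ ha.2 (mem_insert_of_mem h)⟩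
  rw [mem_insert]
  rintro (rfl | h)
  · exact ha.2 (mem_insert_self _ _)
  · exact haB h

lemma shadow_nonMemberSubfamily_subset (x : α) (𝒟 : Finset (Finset α)) :
    ∂ (𝒟.nonMemberSubfamily x) ⊆ (∂ 𝒟).nonMemberSubfamily x := by
  intro B hB
  rw [mem_shadow_iff_insert_mem] at hB
  obtain ⟨a, haB, ha⟩ := hB
  rw [mem_nonMemberSubfamily] at ha ⊢
  rw [mem_shadow_iff_insert_mem]
  exact ⟨⟨a, haB, ha.1⟩, fun h ↦ ha.2 (mem_insert_of_mem h)⟩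

/-- A nonempty family of `r`-subsets of a set with at most `2r - 2` elements has a shadow
exceeding it by at least `r - 1`. -/
lemma card_add_le_card_shadow {V : Finset α} {r : ℕ} {𝒟 : Finset (Finset α)}
    (h𝒟 : 𝒟 ⊆ powersetCard r V) (hV : #V + 2 ≤ 2 * r) (hne : 𝒟.Nonempty) :
    #𝒟 + r ≤ #(∂ 𝒟) + 1 := by
  induction V using Finset.strongInduction generalizing r 𝒟 with
  | H V ih =>
  by_cases hall : ∀ A ∈ 𝒟, A = V
  · obtain ⟨A, hA⟩ := hne
    obtain rfl := hall A hA
    have h𝒟A : 𝒟 = {A} := eq_singleton_iff_unique_mem.2 ⟨hA, hall⟩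
    have hAr : #A = r := (mem_powersetCard.1 (h𝒟 hA)).2
    have : A.image (fun a ↦ A.erase a) ⊆ ∂ 𝒟 := by
      intro B hB
      obtain ⟨a, ha, rfl⟩ := mem_image.1 hB
      exact erase_mem_shadow hA ha
    have := card_le_card this
    rw [card_image_of_injOn A.erase_injOn] at this
    rw [h𝒟A] at this ⊢
    rw [card_singleton]
    omega
  · push Not at hall
    obtain ⟨A, hA, hAV⟩ := hall
    have hAsub := (mem_powersetCard.1 (h𝒟 hA)).1
    obtain ⟨x, hxV, hxA⟩ := exists_of_ssubset (hAsub.ssubset_of_ne hAV)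
    have hVx := card_erase_of_mem hxV
    have hVpos : 0 < #V := card_pos.2 ⟨x, hxV⟩
    have h0 := ih (V.erase x) (erase_ssubset hxV) (r := r) (𝒟 := 𝒟.nonMemberSubfamily x)
      (fun B hB ↦ by
        rw [mem_nonMemberSubfamily] at hB
        obtain ⟨hBV, hBr⟩ := mem_powersetCard.1 (h𝒟 hB.1)
        exact mem_powersetCard.2 ⟨subset_erase.2 ⟨hBV, hB.2⟩, hBr⟩)
      (by omega) ⟨A, mem_nonMemberSubfamily.2 ⟨hA, hxA⟩⟩
    have h1 := card_le_card_shadow (V := V.erase x) (r := r - 1) (𝒟 := 𝒟.memberSubfamily x)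
      (fun B hB ↦ by
        rw [mem_memberSubfamily] at hB
        obtain ⟨hBV, hBr⟩ := mem_powersetCard.1 (h𝒟 hB.1)
        rw [card_insert_of_notMem hB.2] at hBr
        exact mem_powersetCard.2
          ⟨subset_erase.2 ⟨(subset_insert _ _).trans hBV, hB.2⟩, by omega⟩)
      (by omega)
    have h2 := card_le_card (shadow_nonMemberSubfamily_subset x 𝒟)
    have h3 := card_le_card (shadow_memberSubfamily_subset x 𝒟)
    have h4 := card_memberSubfamily_add_card_nonMemberSubfamily x 𝒟
    have h5 := card_memberSubfamily_add_card_nonMemberSubfamily x (∂ 𝒟)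
    omega

/-- Pushing an antichain of sets of size at least `r ≥ #α / 2` down to the `r`-th layer increases
its size by at least `r`, unless the antichain already lies in that layer. -/
lemma card_add_le_card_falling [Fintype α] {𝒜 : Finset (Finset α)} {r : ℕ}
    (hanti : IsAntichain (· ⊆ ·) (𝒜 : Set (Finset α))) (hr : Fintype.card α ≤ 2 * r)
    (h𝒜 : ∀ A ∈ 𝒜, r ≤ #A) (hlarge : ∃ A ∈ 𝒜, r < #A) : #𝒜 + r ≤ #(falling r 𝒜) := by
  have hfall (j : ℕ) : #(falling j 𝒜) = #(𝒜 # j) + #(∂ (falling (j + 1) 𝒜)) := by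
    rw [← card_union_of_disjoint hanti.disjoint_slice_shadow_falling,
      slice_union_shadow_falling_succ]
  have hpow (j : ℕ) : falling j 𝒜 ⊆ powersetCard j univ :=
    fun B hB ↦ mem_powersetCard.2 ⟨subset_univ _, (mem_falling.1 hB).2⟩
  have hsplit (j : ℕ) : #{A ∈ 𝒜 | j ≤ #A} ≤ #(𝒜 # j) + #{A ∈ 𝒜 | j + 1 ≤ #A} := by
    refine (card_le_card fun A hA ↦ ?_).trans (card_union_le _ _)
    rw [mem_filter] at hA
    rw [mem_union, mem_slice, mem_filter]
    rcases hA.2.eq_or_lt with h | h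
    · exact .inl ⟨hA.1, h.symm⟩
    · exact .inr ⟨hA.1, h⟩
  have key (d : ℕ) : ∀ j, r < j → Fintype.card α < j + d →
      #{A ∈ 𝒜 | j ≤ #A} ≤ #(falling j 𝒜) := by
    induction d with
    | zero =>
      intro j _ hj
      rw [filter_false_of_mem]
      · simp
      · intro A _
        have := card_le_univ A
        omega
    | succ d ih =>
      intro j hrj hj
      have h1 := ih (j + 1) (by omega) (by omega)
      have h2 := card_le_card_shadow (hpow (j + 1)) (by rw [card_univ]; omega)
      have h3 := hsplit j
      have h4 := hfall j
      omega
  have h1 := key (Fintype.card α) (r + 1) (by omega) (by omega)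
  obtain ⟨A, hA, hrA⟩ := hlarge
  obtain ⟨B, hBA, hB⟩ := exists_subset_card_eq (show r + 1 ≤ #A from hrA)
  have h2 := card_add_le_card_shadow (hpow (r + 1)) (by rw [card_univ]; omega)
    ⟨B, mem_falling.2 ⟨⟨A, hA, hBA⟩, hB⟩⟩
  have h3 := hsplit r
  have h4 := hfall r
  rw [filter_true_of_mem h𝒜] at h3
  omega

end Shadow

section InitialSegments

variable {n r : ℕ}

lemma exists_isInitSeg_card_eq {s : ℕ} (hs : s ≤ n.choose r) :
    ∃ 𝒞 : Finset (Finset (Fin n)), IsInitSeg 𝒞 r ∧ #𝒞 = s := by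
  induction s with
  | zero => exact ⟨∅, isInitSeg_empty, card_empty⟩
  | succ s ih =>
    obtain ⟨𝒞, h𝒞, hcard⟩ := ih (by omega)
    have hne : (powersetCard r univ \ 𝒞 : Finset (Finset (Fin n))).Nonempty := by
      rw [sdiff_nonempty]
      intro hsub
      have := card_le_card hsub
      rw [card_powersetCard, card_fin] at this
      omega
    obtain ⟨A, hA, hmin⟩ := exists_min_image _ (fun B ↦ toColex B) hne
    rw [mem_sdiff, mem_powersetCard] at hA
    refine ⟨insert A 𝒞, ⟨?_, ?_⟩, by rw [card_insert_of_notMem hA.2, hcard]⟩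
    · intro B hB
      rw [coe_insert] at hB
      rcases hB with rfl | hB
      · exact hA.1.2
      · exact h𝒞.1 hB
    · rintro B t hB ⟨htB, ht⟩
      rcases mem_insert.1 hB with rfl | hB
      · by_contra htn
        refine (hmin t ?_).not_gt htB
        exact mem_sdiff.2 ⟨mem_powersetCard.2 ⟨subset_univ _, ht⟩,
          fun h ↦ htn (mem_insert_of_mem h)⟩
      · exact mem_insert_of_mem (h𝒞.2 hB ⟨htB, ht⟩)

/-- An initial segment of colex is comparable with the family of `r`-subsets of `{0, …, j - 1}`. -/
lemma isInitSeg_subset_or_superset {𝒞 : Finset (Finset (Fin n))} (h𝒞 : IsInitSeg 𝒞 r) (j : ℕ) :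
    𝒞 ⊆ powersetCard r {a : Fin n | (a : ℕ) < j} ∨
      powersetCard r {a : Fin n | (a : ℕ) < j} ⊆ 𝒞 := by
  by_contra! h
  obtain ⟨h1, h2⟩ := h
  rw [not_subset] at h1 h2
  obtain ⟨A, hA, hAj⟩ := h1
  obtain ⟨t, ht, ht𝒞⟩ := h2
  rw [mem_powersetCard] at ht hAj
  have : ¬ A ⊆ ({a : Fin n | (a : ℕ) < j} : Finset (Fin n)) := fun h ↦ hAj ⟨h, h𝒞.1 hA⟩
  obtain ⟨a, haA, haj⟩ := not_subset.1 this
  refine ht𝒞 (h𝒞.2 hA ⟨?_, ht.2⟩)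
  refine lt_of_lt_of_le (toColex_lt_singleton.2 fun b hb ↦ ?_)
    (toColex_mono (singleton_subset_iff.2 haA))
  have hb := (mem_filter.1 (ht.1 hb)).2
  have : ¬ (a : ℕ) < j := fun h ↦ haj (mem_filter.2 ⟨mem_univ _, h⟩)
  exact Fin.lt_def.2 (by omega)

lemma card_filter_val_lt {j : ℕ} (hj : j ≤ n) : #{a : Fin n | (a : ℕ) < j} = j := by
  rw [Fin.card_filter_val_lt, min_eq_right hj]

/-- A nonempty family of at most `(2k-1).choose k` sets of size `k` has a shadow which exceeds it
by at least `k - 1` or is at least as large as the shadow of all `k`-subsets of a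
`(2k-1)`-element set. -/
lemma card_add_le_card_shadow_or {k : ℕ} (hk : 2 ≤ k) (hn : 2 * k - 1 ≤ n)
    {𝒟 : Finset (Finset (Fin n))} (h𝒟 : (𝒟 : Set (Finset (Fin n))).Sized k) (hne : 𝒟.Nonempty)
    (hcard : #𝒟 ≤ (2 * k - 1).choose k) :
    #𝒟 + k ≤ #(∂ 𝒟) + 1 ∨ (2 * k - 1).choose (k - 1) ≤ #(∂ 𝒟) := by
  obtain ⟨𝒞, h𝒞, h𝒞𝒟⟩ := exists_isInitSeg_card_eq (hcard.trans (Nat.choose_le_choose k hn))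
  have hkk := kruskal_katona h𝒟 h𝒞𝒟.le h𝒞
  set W : Finset (Fin n) := {a : Fin n | (a : ℕ) < 2 * k - 1} with hWdef
  set W' : Finset (Fin n) := {a : Fin n | (a : ℕ) < 2 * k - 2} with hWdef'
  have hW : #W = 2 * k - 1 := card_filter_val_lt hn
  have hW' : #W' = 2 * k - 2 := card_filter_val_lt (by omega)
  have h𝒞W : 𝒞 ⊆ powersetCard k W := by
    rcases isInitSeg_subset_or_superset h𝒞 (2 * k - 1) with h | h
    · exact h
    · refine (eq_of_subset_of_card_le h ?_).ge
      rw [card_powersetCard, ← hWdef, hW]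
      omega
  rcases isInitSeg_subset_or_superset h𝒞 (2 * k - 2) with h | h
  · left
    have := card_add_le_card_shadow h (by rw [← hWdef', hW']; omega)
      (card_pos.1 (by rw [h𝒞𝒟]; exact card_pos.2 hne))
    omega
  rw [← hWdef'] at h
  set 𝒯 := powersetCard (k - 1) W \ ∂ 𝒞 with h𝒯
  have hcard𝒯 : (2 * k - 1).choose (k - 1) ≤ #𝒯 + #(∂ 𝒞) := by
    have := le_card_sdiff (∂ 𝒞) (powersetCard (k - 1) W)
    rw [card_powersetCard, hW, ← h𝒯] at this
    omega
  rcases 𝒯.eq_empty_or_nonempty with h0 | h0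
  · rw [h0, card_empty] at hcard𝒯
    omega
  left
  have hsub𝒯 {t : Finset (Fin n)} (ht : t ∈ 𝒯) : t ⊆ W :=
    (mem_powersetCard.1 (mem_sdiff.1 ht).1).1
  have hinj : Set.InjOn (fun t ↦ W \ t) (𝒯 : Set (Finset (Fin n))) := by
    intro s hs t ht hst
    rw [← Finset.sdiff_sdiff_eq_self (hsub𝒯 hs), ← Finset.sdiff_sdiff_eq_self (hsub𝒯 ht)]
    exact congrArg (W \ ·) hst
  have himage : 𝒯.image (fun t ↦ W \ t) ⊆ powersetCard k W' := by
    intro s hs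
    obtain ⟨t, ht, rfl⟩ := mem_image.1 hs
    have htk := (mem_powersetCard.1 (mem_sdiff.1 ht).1).2
    refine mem_powersetCard.2 ⟨fun b hb ↦ ?_, by rw [card_sdiff_of_subset (hsub𝒯 ht)]; omega⟩
    by_contra hbW'
    obtain ⟨hbW, hbt⟩ := mem_sdiff.1 hb
    have hb1 : (b : ℕ) < 2 * k - 1 := (mem_filter.1 hbW).2
    have hb2 : ¬ (b : ℕ) < 2 * k - 2 := fun h ↦ hbW' (mem_filter.2 ⟨mem_univ _, h⟩)
    have htW' : t ⊆ W' := by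
      intro a ha
      have ha1 : (a : ℕ) < 2 * k - 1 := (mem_filter.1 (hsub𝒯 ht ha)).2
      have hab : a ≠ b := fun h ↦ hbt (h ▸ ha)
      have hab' : (a : ℕ) ≠ b := fun h ↦ hab (Fin.ext h)
      exact mem_filter.2 ⟨mem_univ _, by omega⟩
    obtain ⟨a, haW', hat⟩ := exists_mem_notMem_of_card_lt_card (s := t) (t := W') (by omega)
    refine (mem_sdiff.1 ht).2 (mem_shadow_iff_insert_mem.2 ⟨a, hat, h ?_⟩)
    exact mem_powersetCard.2 ⟨insert_subset haW' htW', by rw [card_insert_of_notMem hat]; omega⟩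
  have hup := card_add_le_card_shadow himage (by omega) (h0.image _)
  rw [card_image_of_injOn hinj] at hup
  set ℬ := 𝒯.image (fun t ↦ W \ t)
  have hsubℬ {B : Finset (Fin n)} (hB : B ∈ ∂ ℬ) :
      ∃ a t, t ∈ 𝒯 ∧ a ∉ t ∧ a ∈ W ∧ W \ B = insert a t := by
    obtain ⟨s, hs, a, ha, rfl⟩ := mem_shadow_iff.1 hB
    obtain ⟨t, ht, rfl⟩ := mem_image.1 hs
    refine ⟨a, t, ht, (mem_sdiff.1 ha).2, (mem_sdiff.1 ha).1, ?_⟩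
    rw [sdiff_erase (mem_sdiff.1 ha).1, Finset.sdiff_sdiff_eq_self (hsub𝒯 ht)]
  have hBW {B : Finset (Fin n)} (hB : B ∈ ∂ ℬ) : B ⊆ W := by
    obtain ⟨s, hs, hBs⟩ := exists_subset_of_mem_shadow hB
    obtain ⟨t, ht, rfl⟩ := mem_image.1 hs
    exact hBs.trans sdiff_subset
  have hinj' : Set.InjOn (fun t ↦ W \ t) (∂ ℬ : Set (Finset (Fin n))) := by
    intro s hs t ht hst
    rw [← Finset.sdiff_sdiff_eq_self (hBW hs), ← Finset.sdiff_sdiff_eq_self (hBW ht)]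
    exact congrArg (W \ ·) hst
  have hout : (∂ ℬ).image (fun t ↦ W \ t) ⊆ powersetCard k W \ 𝒞 := by
    intro s hs
    obtain ⟨B, hB, rfl⟩ := mem_image.1 hs
    obtain ⟨a, t, ht, hat, haW, hBt⟩ := hsubℬ hB
    obtain ⟨ht1, ht2⟩ := mem_sdiff.1 ht
    have htk := (mem_powersetCard.1 ht1).2
    simp only [hBt]
    refine mem_sdiff.2 ⟨mem_powersetCard.2 ⟨insert_subset haW (hsub𝒯 ht), ?_⟩, fun hmem ↦ ?_⟩
    · rw [card_insert_of_notMem hat]; omega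
    · exact ht2 (mem_shadow_iff_insert_mem.2 ⟨a, hat, hmem⟩)
  have hle := card_le_card hout
  rw [card_image_of_injOn hinj', card_sdiff_of_subset h𝒞W, card_powersetCard, hW] at hle
  have hsymm : (2 * k - 1).choose k = (2 * k - 1).choose (k - 1) :=
    Nat.choose_symm_of_eq_add (by omega)
  omega

end InitialSegments

section Intersecting

lemma sq_le_choose_add_one {k : ℕ} (hk : 2 ≤ k) : k ^ 2 ≤ (2 * k - 1).choose (k - 1) + 1 := by
  induction k, hk using Nat.le_induction with
  | base => decide
  | succ k hk ih =>
    obtain ⟨j, rfl⟩ : ∃ j, k = j + 2 := ⟨k - 2, by omega⟩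
    have h1 : 2 * (j + 2) - 1 = 2 * j + 3 := by omega
    have h2 : 2 * (j + 2 + 1) - 1 = 2 * j + 3 + 1 + 1 := by omega
    have h3 : j + 2 - 1 = j + 1 := by omega
    have h4 : j + 2 + 1 - 1 = j + 1 + 1 := by omega
    rw [h1, h3] at ih
    rw [h2, h4, Nat.choose_succ_succ, Nat.choose_succ_succ, Nat.choose_succ_succ (2 * j + 3)]
    have h5 : (2 * j + 3).choose (j + 1 + 1) = (2 * j + 3).choose (j + 1) :=
      Nat.choose_symm_of_eq_add (by omega)
    rw [h5]
    nlinarith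

/-- The case `n = 2k + 1` of the **Hilton–Milner theorem**: a large intersecting family of
`k`-subsets of a `(2k+1)`-element set is a star. -/
theorem exists_forall_mem_of_intersecting {m k : ℕ} (hk : 2 ≤ k) (hm : m = 2 * k + 1)
    {𝒜 : Finset (Finset (Fin m))} (hsized : (𝒜 : Set (Finset (Fin m))).Sized k)
    (hint : (𝒜 : Set (Finset (Fin m))).Intersecting)
    (hcard : (2 * k).choose (k - 1) + 1 < #𝒜 + k) : ∃ x, ∀ A ∈ 𝒜, x ∈ A := by
  by_contra! hstar
  have hdeg : ∀ x, #{A ∈ 𝒜 | x ∈ A} ≤ (2 * k - 1).choose (k - 2) := by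
    intro x
    set V : Finset (Fin m) := univ.erase x with hV
    have hVcard : #V = 2 * k := by rw [hV, card_erase_of_mem (mem_univ x), card_fin]; omega
    set ℬ : Finset (Finset (Fin m)) := {A ∈ 𝒜 | x ∉ A} with hℬ
    have hℬV {A : Finset (Fin m)} (hA : A ∈ ℬ) : A ⊆ V :=
      subset_erase.2 ⟨subset_univ _, (mem_filter.1 hA).2⟩
    have hℬ𝒜 {A : Finset (Fin m)} (hA : A ∈ ℬ) : A ∈ 𝒜 := (mem_filter.1 hA).1
    set 𝒟 := ℬ.image (fun A ↦ V \ A)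
    have hinj : Set.InjOn (fun A ↦ V \ A) (ℬ : Set (Finset (Fin m))) := by
      intro s hs t ht hst
      rw [← Finset.sdiff_sdiff_eq_self (hℬV hs), ← Finset.sdiff_sdiff_eq_self (hℬV ht)]
      exact congrArg (V \ ·) hst
    have h𝒟card : #𝒟 = #ℬ := card_image_of_injOn hinj
    have h𝒟V : 𝒟 ⊆ powersetCard k V := by
      intro D hD
      obtain ⟨A, hA, rfl⟩ := mem_image.1 hD
      refine mem_powersetCard.2 ⟨sdiff_subset, ?_⟩
      rw [card_sdiff_of_subset (hℬV hA), hVcard, hsized (hℬ𝒜 hA)]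
      omega
    have hℬpow : ℬ ⊆ powersetCard k V :=
      fun A hA ↦ mem_powersetCard.2 ⟨hℬV hA, hsized (hℬ𝒜 hA)⟩
    have hdisj : Disjoint ℬ 𝒟 := by
      rw [disjoint_right]
      intro D hD hDℬ
      obtain ⟨A, hA, rfl⟩ := mem_image.1 hD
      exact hint (hℬ𝒜 hDℬ) (hℬ𝒜 hA) disjoint_sdiff_self_left
    have hne : 𝒟.Nonempty := by
      obtain ⟨A, hA, hxA⟩ := hstar x
      exact ⟨_, mem_image_of_mem _ (mem_filter.2 ⟨hA, hxA⟩)⟩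
    obtain ⟨j, rfl⟩ : ∃ j, k = j + 2 := ⟨k - 2, by omega⟩
    have e1 : 2 * (j + 2) - 1 = 2 * j + 3 := by omega
    have e2 : 2 * (j + 2) = 2 * j + 3 + 1 := by omega
    have e3 : j + 2 - 1 = j + 1 := by omega
    have e4 : j + 2 - 2 = j := by omega
    have p1 := Nat.choose_succ_succ (2 * j + 3) j
    have p2 := Nat.choose_succ_succ (2 * j + 3) (j + 1)
    have p3 : (2 * j + 3).choose (j + 1 + 1) = (2 * j + 3).choose (j + 1) :=
      Nat.choose_symm_of_eq_add (by omega)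
    simp only [Nat.succ_eq_add_one] at p1 p2
    rw [e3] at hcard
    have hhalf : #𝒟 ≤ (2 * j + 3).choose (j + 2) := by
      have := card_le_card (union_subset hℬpow h𝒟V)
      rw [card_union_of_disjoint hdisj, card_powersetCard, hVcard, e2] at this
      have e5 : j + 2 = j + 1 + 1 := rfl
      rw [e5] at this ⊢
      omega
    have hdich := card_add_le_card_shadow_or (by omega) (by omega)
      (fun D hD ↦ (mem_powersetCard.1 (h𝒟V hD)).2) hne (by rw [e1]; exact hhalf)
    set 𝒮 : Finset (Finset (Fin m)) :=
      ({A ∈ 𝒜 | x ∈ A} : Finset _).image (fun A ↦ A.erase x)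
    have h𝒮card : #𝒮 = #{A ∈ 𝒜 | x ∈ A} := by
      refine card_image_of_injOn fun s hs t ht hst ↦ ?_
      rw [← insert_erase (mem_filter.1 hs).2, ← insert_erase (mem_filter.1 ht).2]
      exact congrArg (insert x) hst
    have h𝒮pow : 𝒮 ⊆ powersetCard (j + 1) V := by
      intro S hS
      obtain ⟨A, hA, rfl⟩ := mem_image.1 hS
      obtain ⟨hA, hxA⟩ := mem_filter.1 hA
      refine mem_powersetCard.2 ⟨erase_subset_erase _ (subset_univ _), ?_⟩
      rw [card_erase_of_mem hxA, hsized hA]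
      omega
    have hshadowpow : ∂ 𝒟 ⊆ powersetCard (j + 1) V := by
      intro S hS
      obtain ⟨D, hD, hSD⟩ := exists_subset_of_mem_shadow hS
      have hs : (𝒟 : Set (Finset (Fin m))).Sized (j + 2) :=
        fun D hD ↦ (mem_powersetCard.1 (h𝒟V hD)).2
      exact mem_powersetCard.2
        ⟨hSD.trans (mem_powersetCard.1 (h𝒟V hD)).1, hs.shadow hS⟩
    have hdisj' : Disjoint 𝒮 (∂ 𝒟) := by
      rw [disjoint_left]
      intro S hS hS'
      obtain ⟨A, hA, rfl⟩ := mem_image.1 hS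
      obtain ⟨hA, hxA⟩ := mem_filter.1 hA
      obtain ⟨D, hD, hSD⟩ := exists_subset_of_mem_shadow hS'
      obtain ⟨B, hB, rfl⟩ := mem_image.1 hD
      refine hint hA (hℬ𝒜 hB) (disjoint_left.2 fun a haA haB ↦ ?_)
      have hax : a ≠ x := by
        rintro rfl
        exact (mem_filter.1 hB).2 haB
      exact (mem_sdiff.1 (hSD (mem_erase.2 ⟨hax, haA⟩))).2 haB
    have htot := card_le_card (union_subset h𝒮pow hshadowpow)
    rw [card_union_of_disjoint hdisj', card_powersetCard, hVcard, e2] at htot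
    have hpart := card_filter_add_card_filter_not (s := 𝒜) (fun A ↦ x ∈ A)
    rw [e1, e3] at hdich
    rw [e2] at hcard
    rw [e1, e4]
    rw [← hℬ] at hpart
    omega
  have hsum : ∑ x, #{A ∈ 𝒜 | x ∈ A} = #𝒜 * k := by
    have := sum_card_bipartiteAbove_eq_sum_card_bipartiteBelow
      (s := (univ : Finset (Fin m))) (t := 𝒜) (fun x A ↦ x ∈ A)
    refine this.trans ?_
    refine sum_const_nat fun A hA ↦ ?_
    rw [bipartiteBelow, filter_mem_eq_inter, univ_inter, hsized hA]
  have hle := sum_le_card_nsmul univ _ _ fun x _ ↦ hdeg x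
  rw [hsum, card_fin, smul_eq_mul] at hle
  replace hle := hle.trans_eq (congrArg (· * _) hm)
  have hsq := sq_le_choose_add_one hk
  obtain ⟨j, rfl⟩ : ∃ j, k = j + 2 := ⟨k - 2, by omega⟩
  have e1 : 2 * (j + 2) - 1 = 2 * j + 3 := by omega
  have e2 : 2 * (j + 2) = 2 * j + 3 + 1 := by omega
  have e3 : j + 2 - 1 = j + 1 := by omega
  have e4 : j + 2 - 2 = j := by omega
  rw [e1, e4] at hle
  rw [e1, e3] at hsq
  rw [e3, e2, Nat.choose_succ_succ] at hcard
  have hmul := Nat.choose_succ_right_eq (2 * j + 3) j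
  rw [show 2 * j + 3 - j = j + 3 by omega] at hmul
  simp only [Nat.succ_eq_add_one] at hcard
  nlinarith

end Intersecting

section Arrays

variable {m n : ℕ}

/-- If a large family of pairwise incomparable and intersecting sets has all sizes at most
`⌊m/2⌋`, then all its sizes are `⌊m/2⌋`. -/
lemma card_eq_half (hm : 4 ≤ m) (hn : (m - 1).choose (m / 2 - 1) + m < n + 3 * (m / 2))
    {R : Fin n → Finset (Fin m)} (hcard : ∀ i, #(R i) ≤ m / 2)
    (hsub : ∀ i j, i ≠ j → ¬ R i ⊆ R j) (hint : ∀ i j, i ≠ j → ¬ Disjoint (R i) (R j)) (i : Fin n) :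
    #(R i) = m / 2 := by
  have hn2 : 2 ≤ n := by
    have h1 := sq_le_choose_add_one (show 2 ≤ m / 2 by omega)
    have h2 : (2 * (m / 2) - 1).choose (m / 2 - 1) ≤ (m - 1).choose (m / 2 - 1) :=
      Nat.choose_le_choose _ (by omega)
    have h3 : 3 * (m / 2) + 1 ≤ (m / 2) ^ 2 + m - 1 := by
      obtain ⟨j, hj⟩ : ∃ j, m / 2 = j + 2 := ⟨m / 2 - 2, by omega⟩
      have : (j + 2) ^ 2 = j * j + 4 * j + 4 := by ring
      rw [hj, this]
      omega
    omega
  by_contra hi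
  replace hi : #(R i) < m / 2 := lt_of_le_of_ne (hcard i) hi
  have : Nontrivial (Fin n) := Fin.nontrivial_iff_two_le.2 hn2
  have hint' (i j) : ¬ Disjoint (R i) (R j) := by
    rcases eq_or_ne i j with rfl | hij
    · obtain ⟨j, hj⟩ := exists_ne i
      rw [disjoint_self]
      intro h0
      exact hsub i j hj.symm (by rw [h0]; exact bot_le)
    · exact hint i j hij
  have hinj : Function.Injective fun i ↦ (R i)ᶜ := by
    intro i j hij
    by_contra hne
    exact hsub i j hne (compl_injective hij).le
  set 𝒜 : Finset (Finset (Fin m)) := univ.image fun i ↦ (R i)ᶜ with h𝒜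
  have h𝒜card : #𝒜 = n := by rw [h𝒜, card_image_of_injective _ hinj, card_fin]
  have hanti : IsAntichain (· ⊆ ·) (𝒜 : Set (Finset (Fin m))) := by
    intro A hA B hB hAB hle
    obtain ⟨i, -, rfl⟩ := mem_image.1 hA
    obtain ⟨j, -, rfl⟩ := mem_image.1 hB
    refine hsub j i ?_ (compl_subset_compl.1 hle)
    rintro rfl
    exact hAB rfl
  have hfall := card_add_le_card_falling (r := m - m / 2) hanti (by rw [Fintype.card_fin]; omega)
    (fun A hA ↦ by
      obtain ⟨j, -, rfl⟩ := mem_image.1 hA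
      have := hcard j
      rw [card_compl, Fintype.card_fin]
      omega)
    ⟨(R i)ᶜ, mem_image_of_mem _ (mem_univ i), by rw [card_compl, Fintype.card_fin]; omega⟩
  have hekr := erdos_ko_rado (𝒜 := (falling (m - m / 2) 𝒜).image compl) (r := m / 2)
    (by
      intro A hA B hB hAB
      obtain ⟨A, hAf, rfl⟩ := mem_image.1 hA
      obtain ⟨B, hBf, rfl⟩ := mem_image.1 hB
      obtain ⟨⟨A', hA', hAA'⟩, -⟩ := mem_falling.1 hAf
      obtain ⟨⟨B', hB', hBB'⟩, -⟩ := mem_falling.1 hBf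
      obtain ⟨i, -, rfl⟩ := mem_image.1 hA'
      obtain ⟨j, -, rfl⟩ := mem_image.1 hB'
      exact hint' i j (hAB.mono (subset_compl_comm.1 hAA') (subset_compl_comm.1 hBB')))
    (by
      intro A hA
      obtain ⟨A, hAf, rfl⟩ := mem_image.1 hA
      rw [card_compl, Fintype.card_fin, (mem_falling.1 hAf).2]
      omega)
    le_rfl
  rw [card_image_of_injective _ compl_injective] at hekr
  omega

/-- A large family of pairwise intersecting sets of size `⌊m/2⌋` is a star when `m` is odd. -/
lemma exists_common_mem_of_odd (hm : 4 ≤ m) (hodd : Odd m)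
    (hn : (m - 1).choose (m / 2 - 1) + m < n + 3 * (m / 2))
    {R : Fin n → Finset (Fin m)} (hcard : ∀ i, #(R i) = m / 2)
    (hinj : Function.Injective R) (hint : ∀ i j, i ≠ j → ¬ Disjoint (R i) (R j)) :
    ∃ x, ∀ i, x ∈ R i := by
  have hm' : m = 2 * (m / 2) + 1 := (Nat.two_mul_div_two_add_one_of_odd hodd).symm
  obtain ⟨x, hx⟩ := exists_forall_mem_of_intersecting (𝒜 := univ.image R) (by omega) hm'
    (fun A hA ↦ by
      obtain ⟨i, -, rfl⟩ := mem_image.1 hA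
      exact hcard i)
    (fun A hA B hB hAB ↦ by
      obtain ⟨i, -, rfl⟩ := mem_image.1 hA
      obtain ⟨j, -, rfl⟩ := mem_image.1 hB
      rcases eq_or_ne i j with rfl | hij
      · rw [disjoint_self] at hAB
        have := hcard i
        rw [hAB, bot_eq_empty, card_empty] at this
        omega
      · exact hint i j hij hAB)
    (by
      rw [card_image_of_injective _ hinj, card_fin]
      have : 2 * (m / 2) = m - 1 := by omega
      rw [this]
      omega)
  exact ⟨x, fun i ↦ hx _ (mem_image_of_mem _ (mem_univ i))⟩

lemma exists_row_of_isCoveringArray {C : Fin m → Fin n → Fin 2} (hC : IsCoveringArray m n 2 2 C)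
    (f : Fin n → Equiv.Perm (Fin 2)) {i j : Fin n} (hij : i ≠ j) (a b : Fin 2) :
    ∃ r, f i (C r i) = a ∧ f j (C r j) = b := by
  obtain ⟨r, hr⟩ := hC ![i, j] (by
    intro s t hst
    fin_cases s <;> fin_cases t <;> simp_all [eq_comm]) ![(f i).symm a, (f j).symm b]
  have h0 := hr 0
  have h1 := hr 1
  simp only [Matrix.cons_val_zero, Matrix.cons_val_one] at h0 h1
  exact ⟨r, by simp [h0], by simp [h1]⟩

/-- The support of the `i`-th column after applying the permutation `f` to its entries. -/
def permSupp (C : Fin m → Fin n → Fin 2) (f : Equiv.Perm (Fin 2)) (i : Fin n) : Finset (Fin m) :=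
  {r | f (C r i) = 1}

lemma mem_permSupp {C : Fin m → Fin n → Fin 2} {f : Equiv.Perm (Fin 2)} {i : Fin n} {r : Fin m} :
    r ∈ permSupp C f i ↔ f (C r i) = 1 := by simp [permSupp]

lemma card_permSupp_one (C : Fin m → Fin n → Fin 2) (i : Fin n) :
    #(permSupp C 1 i) = colWt C i := by
  refine congrArg card (filter_congr fun r _ ↦ ?_)
  generalize C r i = a
  revert a
  decide

lemma card_permSupp_swap (C : Fin m → Fin n → Fin 2) (i : Fin n) :
    #(permSupp C (Equiv.swap 0 1) i) = m - colWt C i := by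
  have : permSupp C (Equiv.swap 0 1) i = (permSupp C 1 i)ᶜ := by
    ext r
    rw [mem_compl, mem_permSupp, mem_permSupp]
    generalize C r i = a
    revert a
    decide
  rw [this, card_compl, Fintype.card_fin, card_permSupp_one]

lemma colWt_le (C : Fin m → Fin n → Fin 2) (i : Fin n) : colWt C i ≤ m :=
  (card_le_univ _).trans (Fintype.card_fin m).le

lemma not_permSupp_subset {C : Fin m → Fin n → Fin 2} (hC : IsCoveringArray m n 2 2 C)
    (f : Fin n → Equiv.Perm (Fin 2)) {i j : Fin n} (hij : i ≠ j) :
    ¬ permSupp C (f i) i ⊆ permSupp C (f j) j := by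
  intro h
  obtain ⟨r, h1, h0⟩ := exists_row_of_isCoveringArray hC f hij 1 0
  have := mem_permSupp.1 (h (mem_permSupp.2 h1))
  rw [h0] at this
  exact zero_ne_one this

lemma not_disjoint_permSupp {C : Fin m → Fin n → Fin 2} (hC : IsCoveringArray m n 2 2 C)
    (f : Fin n → Equiv.Perm (Fin 2)) {i j : Fin n} (hij : i ≠ j) :
    ¬ Disjoint (permSupp C (f i) i) (permSupp C (f j) j) := by
  obtain ⟨r, hi, hj⟩ := exists_row_of_isCoveringArray hC f hij 1 1
  exact not_disjoint_iff.2 ⟨r, mem_permSupp.2 hi, mem_permSupp.2 hj⟩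

lemma permSupp_injective {C : Fin m → Fin n → Fin 2} (hC : IsCoveringArray m n 2 2 C)
    (f : Fin n → Equiv.Perm (Fin 2)) : Function.Injective fun i ↦ permSupp C (f i) i := by
  intro i j hij
  by_contra hne
  exact not_permSupp_subset hC f hne (subset_of_eq hij)

/-- A covering array whose columns can be complemented so that all supports have size `⌊m/2⌋` and
share a row is equivalent to a selection of columns of the standard maximal array. -/
lemma exists_isStandardMaxArray (hm : 4 ≤ m) {C : Fin m → Fin n → Fin 2}
    (hC : IsCoveringArray m n 2 2 C) (f : Fin n → Equiv.Perm (Fin 2)) (x : Fin m)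
    (hx : ∀ i, x ∈ permSupp C (f i) i) (hcard : ∀ i, #(permSupp C (f i) i) = m / 2) :
    ∃ (S : Fin m → Fin ((m - 1).choose (m / 2 - 1)) → Fin 2)
      (g : Fin n → Fin ((m - 1).choose (m / 2 - 1))),
      IsStandardMaxArray m S ∧ Function.Injective g ∧ CAEquiv C (fun r i ↦ S r (g i)) := by
  set z : Fin m := ⟨0, by omega⟩ with hz
  set T : Finset (Finset (Fin m)) := (powersetCard (m / 2 - 1) (univ.erase z)).image (insert z)
    with hT
  have hTcard : #T = (m - 1).choose (m / 2 - 1) := by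
    rw [hT, card_image_of_injOn, card_powersetCard, card_erase_of_mem (mem_univ z), card_fin]
    intro s hs t ht hst
    have hs := (subset_erase.1 (mem_powersetCard.1 hs).1).2
    have ht := (subset_erase.1 (mem_powersetCard.1 ht).1).2
    rw [← erase_insert hs, ← erase_insert ht]
    exact congrArg (erase · z) hst
  have hTmem {A : Finset (Fin m)} : A ∈ T ↔ z ∈ A ∧ #A = m / 2 := by
    constructor
    · intro hA
      obtain ⟨B, hB, rfl⟩ := mem_image.1 hA
      obtain ⟨hBz, hB⟩ := mem_powersetCard.1 hB
      refine ⟨mem_insert_self _ _, ?_⟩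
      rw [card_insert_of_notMem (subset_erase.1 hBz).2, hB]
      omega
    · rintro ⟨hzA, hA⟩
      refine mem_image.2 ⟨A.erase z, mem_powersetCard.2 ⟨?_, ?_⟩, insert_erase hzA⟩
      · exact erase_subset_erase _ (subset_univ _)
      · rw [card_erase_of_mem hzA, hA]
  set e := T.equivFinOfCardEq hTcard
  set σ : Equiv.Perm (Fin m) := Equiv.swap z x with hσ
  set Q : Fin n → Finset (Fin m) := fun i ↦ (permSupp C (f i) i).map σ.symm.toEmbedding with hQ
  have hQmem (i r) : r ∈ Q i ↔ f i (C (σ r) i) = 1 := by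
    rw [hQ, mem_map_equiv, mem_permSupp, Equiv.symm_symm]
  have hQT (i) : Q i ∈ T := by
    refine hTmem.2 ⟨?_, by rw [hQ, card_map, hcard]⟩
    rw [hQmem, hσ, Equiv.swap_apply_left]
    exact mem_permSupp.1 (hx i)
  refine ⟨fun r c ↦ if r ∈ (e.symm c).1 then 1 else 0, fun i ↦ e ⟨Q i, hQT i⟩,
    ⟨?_, ?_, ?_⟩, ?_, σ, 1, f, ?_⟩
  · intro r c hr
    have : r = z := Fin.ext hr
    rw [this]
    exact if_pos (hTmem.1 (e.symm c).2).1
  · intro c d hcd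
    refine e.symm.injective (Subtype.ext (Finset.ext fun r ↦ ?_))
    have := congrFun hcd r
    by_cases h1 : r ∈ (e.symm c).1 <;> by_cases h2 : r ∈ (e.symm d).1 <;> simp_all
  · intro c
    obtain ⟨hzc, hc⟩ := hTmem.1 (e.symm c).2
    refine Eq.trans ?_ ((card_erase_of_mem hzc).trans (congrArg (· - 1) hc))
    refine congrArg card (Finset.ext fun r ↦ ?_)
    simp [hz, Fin.ext_iff]
  · intro i j hij
    have := congrArg Subtype.val (e.injective hij)
    exact permSupp_injective hC f (map_injective _ this)
  · intro r i
    simp only [Equiv.symm_apply_apply, hQmem, Equiv.Perm.coe_one, id_eq]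
    generalize f i (C (σ r) i) = a
    revert a
    decide

end Arrays

end NearMaximal

/-- for `m ≥ 4` and `n > binom(m-1, ⌊m/2⌋-1) + m - 3⌊m/2⌋`, every `m × n`
binary 2-covering array is equivalent to a matrix obtained by deleting columns (i.e. an
injective selection of `n` columns) from the standard maximal binary 2-covering array of
size `m`; moreover each column has weight `⌊m/2⌋` if `m` is even, and weight `⌊m/2⌋` or
`⌊m/2⌋ + 1` if `m` is odd. -/
theorem structure_near_maximal (m n : ℕ) (hm : 4 ≤ m)
    (hn : (m-1).choose (m/2 - 1) + m < n + 3 * (m/2))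
    (C : Fin m → Fin n → Fin 2) (hC : IsCoveringArray m n 2 2 C) :
    (∃ (S : Fin m → Fin ((m-1).choose (m/2 - 1)) → Fin 2)
       (g : Fin n → Fin ((m-1).choose (m/2 - 1))),
      IsStandardMaxArray m S ∧ Function.Injective g ∧
        CAEquiv C (fun r i => S r (g i))) ∧
    (∀ i : Fin n,
      (Even m → colWt C i = m / 2) ∧
      (Odd m → colWt C i = m / 2 ∨ colWt C i = m / 2 + 1)) := by
  open NearMaximal in
  have hle := colWt_le C
  obtain ⟨f, hf⟩ : ∃ f : Fin n → Equiv.Perm (Fin 2), ∀ i,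
      f i = if colWt C i ≤ m / 2 then 1 else Equiv.swap 0 1 := ⟨_, fun _ => rfl⟩
  have hf1 (i) (hi : colWt C i ≤ m / 2) : (permSupp C (f i) i).card = colWt C i := by
    rw [hf, if_pos hi, card_permSupp_one]
  have hf2 (i) (hi : ¬ colWt C i ≤ m / 2) : (permSupp C (f i) i).card = m - colWt C i := by
    rw [hf, if_neg hi, card_permSupp_swap]
  have hcard : ∀ i, (permSupp C (f i) i).card = m / 2 := by
    refine card_eq_half hm hn (fun i => ?_) (fun i j hij => not_permSupp_subset hC f hij)
      fun i j hij => not_disjoint_permSupp hC f hij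
    by_cases hi : colWt C i ≤ m / 2
    · rw [hf1 i hi]; exact hi
    · rw [hf2 i hi]; omega
  have hwt (i) : (Even m → colWt C i = m / 2) ∧
      (Odd m → colWt C i = m / 2 ∨ colWt C i = m / 2 + 1) := by
    have h0 := hcard i
    have h1 := hle i
    rw [Nat.even_iff, Nat.odd_iff]
    by_cases hi : colWt C i ≤ m / 2
    · rw [hf1 i hi] at h0; omega
    · rw [hf2 i hi] at h0; omega
  refine ⟨?_, hwt⟩
  rcases Nat.even_or_odd m with heven | hodd
  · let z : Fin m := ⟨0, by omega⟩
    have hflip (i) : ∃ p : Equiv.Perm (Fin 2), z ∈ permSupp C p i ∧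
        (permSupp C p i).card = m / 2 := by
      have hi := (hwt i).1 heven
      rw [Nat.even_iff] at heven
      by_cases hz : C z i = 1
      · exact ⟨1, mem_permSupp.2 hz, by rw [card_permSupp_one, hi]⟩
      · refine ⟨Equiv.swap 0 1, mem_permSupp.2 ?_, by rw [card_permSupp_swap, hi]; omega⟩
        have hz0 : C z i = 0 := by omega
        rw [hz0, Equiv.swap_apply_left]
    choose p hp using hflip
    exact exists_isStandardMaxArray hm hC p z (fun i => (hp i).1) fun i => (hp i).2
  · obtain ⟨x, hx⟩ := exists_common_mem_of_odd hm hodd hn hcard (permSupp_injective hC f)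
      fun i j hij => not_disjoint_permSupp hC f hij
    exact exists_isStandardMaxArray hm hC f x hx hcard
end

section
/- Let m ≥ 6 and n = binom(m−1, ⌊m/2⌋−1) − 1. Then every m×n binary 2-covering array is equivalent to a matrix obtained by deleting one column from the standard maximal binary 2-covering array of size m; consequently, any two m×n binary 2-covering arrays with these parameters are equivalent. -/
namespace CoveringArray

open Finset Colex
open scoped FinsetFamily

theorem card_add_two_le_of_bipartite {α β : Type*} [DecidableEq β] {s : Finset α} {t : Finset β}
    (r : α → β → Prop) [∀ a b, Decidable (r a b)] {d : ℕ} (hd : 3 ≤ d)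
    (hs : ∀ a ∈ s, d ≤ #(t.bipartiteAbove r a))
    (ht : ∀ b ∈ t, #(s.bipartiteBelow r b) ≤ d - 1)
    (hst : ∀ a ∈ s, ∀ a' ∈ s, a ≠ a' → ∀ b ∈ t, ∀ b' ∈ t,
      r a b → r a' b → r a b' → r a' b' → b = b')
    (hne : s.Nonempty) : #s + 2 ≤ #t := by
  have hmul := card_mul_le_card_mul r hs ht
  obtain ⟨a, ha⟩ := hne
  have hone : d ≤ #t := (hs a ha).trans (card_le_card (filter_subset _ _))
  rcases lt_trichotomy #s (d - 1) with h | h | h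
  · omega
  · obtain ⟨a', ha', hne⟩ := exists_mem_ne (by omega : 1 < #s) a
    have hinter : #(t.bipartiteAbove r a ∩ t.bipartiteAbove r a') ≤ 1 := by
      refine card_le_one.2 fun b hb b' hb' => ?_
      simp only [mem_inter, mem_bipartiteAbove] at hb hb'
      exact hst a ha a' ha' hne.symm b hb.1.1 b' hb'.1.1 hb.1.2 hb.2.2 hb'.1.2 hb'.2.2
    have hunion : #(t.bipartiteAbove r a ∪ t.bipartiteAbove r a') ≤ #t :=
      card_le_card (union_subset (filter_subset _ _) (filter_subset _ _))
    have := card_union_add_card_inter (t.bipartiteAbove r a) (t.bipartiteAbove r a')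
    have := hs a ha
    have := hs a' ha'
    omega
  · by_contra! hlt
    obtain ⟨e, rfl⟩ : ∃ e, d = e + 1 := ⟨d - 1, by omega⟩
    simp only [Nat.add_sub_cancel] at hmul h
    have : #t * e ≤ (#s + 1) * e := Nat.mul_le_mul_right _ (by omega)
    nlinarith

theorem eq_of_common_superset {α : Type*} [DecidableEq α] {r : ℕ} {a a' b b' : Finset α}
    (ha : #a = r) (ha' : #a' = r) (hb : #b = r + 1) (hb' : #b' = r + 1) (hne : a ≠ a')
    (hab : a ⊆ b) (hab' : a' ⊆ b) (hb1 : a ⊆ b') (hb2 : a' ⊆ b') : b = b' := by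
  have hlt : r < #(a ∪ a') := by
    by_contra! h
    have h1 := eq_of_subset_of_card_le (subset_union_left : a ⊆ a ∪ a') (by omega)
    have h2 := eq_of_subset_of_card_le (subset_union_right : a' ⊆ a ∪ a') (by omega)
    exact hne (h1.trans h2.symm)
  have h1 := eq_of_subset_of_card_le (union_subset hab hab') (by omega)
  have h2 := eq_of_subset_of_card_le (union_subset hb1 hb2) (by omega)
  exact h1.symm.trans h2

theorem eq_of_common_subset {α : Type*} [DecidableEq α] {r : ℕ} {a a' b b' : Finset α}
    (ha : #a = r + 1) (ha' : #a' = r + 1) (hb : #b = r) (hb' : #b' = r) (hne : a ≠ a')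
    (hab : b ⊆ a) (hab' : b ⊆ a') (hb1 : b' ⊆ a) (hb2 : b' ⊆ a') : b = b' := by
  by_contra h
  exact hne (eq_of_common_superset hb hb' ha ha' h hab hb1 hab' hb2)

/-- Few members of a uniform family lie in a given set with one more element. -/
theorem card_filter_subset_le {α : Type*} [DecidableEq α] {r : ℕ} {s : Finset (Finset α)}
    (hs : ∀ a ∈ s, #a = r) {b u : Finset α} (hb : #b = r + 1)
    (hu : ∀ a ∈ s, a ⊆ b → u ⊆ a) (hub : u ⊆ b) : #{a ∈ s | a ⊆ b} ≤ r + 1 - #u := by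
  rw [← hb, ← card_sdiff_of_subset hub]
  refine (card_le_card (t := (b \ u).image b.erase) fun a ha => ?_).trans card_image_le
  rw [mem_filter] at ha
  obtain ⟨x, hx, rfl⟩ := covBy_iff_exists_erase.1
    (covBy_iff_card_sdiff_eq_one.2 ⟨ha.2, by rw [card_sdiff_of_subset ha.2, hs a ha.1]; omega⟩)
  exact mem_image.2 ⟨x, mem_sdiff.2 ⟨hx, fun h => notMem_erase x b (hu _ ha.1 ha.2 h)⟩, rfl⟩

/-- Few members of a uniform family of subsets of `v` contain a given set with one less element. -/
theorem card_filter_superset_le {α : Type*} [DecidableEq α] {r : ℕ} {s : Finset (Finset α)}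
    (hs : ∀ a ∈ s, #a = r + 1) {b v : Finset α} (hb : #b = r)
    (hv : ∀ a ∈ s, a ⊆ v) (hbv : b ⊆ v) : #{a ∈ s | b ⊆ a} ≤ #v - r := by
  rw [← hb, ← card_sdiff_of_subset hbv]
  refine (card_le_card (t := (v \ b).image (insert · b)) fun a ha => ?_).trans card_image_le
  rw [mem_filter] at ha
  obtain ⟨x, hx, rfl⟩ := covBy_iff_exists_insert.1
    (covBy_iff_card_sdiff_eq_one.2 ⟨ha.2, by rw [card_sdiff_of_subset ha.2, hs a ha.1]; omega⟩)
  exact mem_image.2 ⟨x, mem_sdiff.2 ⟨hv _ ha.1 (mem_insert_self _ _), hx⟩, rfl⟩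

theorem le_card_filter_superset {α : Type*} [DecidableEq α] {t : Finset (Finset α)}
    {a v : Finset α} (ht : ∀ x ∈ v \ a, insert x a ∈ t) :
    #(v \ a) ≤ #{b ∈ t | a ⊆ b} := by
  rw [← card_image_of_injOn (s := v \ a) (f := (insert · a))]
  · refine card_le_card fun b hb => ?_
    obtain ⟨x, hx, rfl⟩ := mem_image.1 hb
    exact mem_filter.2 ⟨ht x hx, subset_insert _ _⟩
  · intro x hx y hy hxy
    simp only [coe_sdiff, Set.mem_sdiff, mem_coe] at hx hy
    have : x ∈ insert y a := by rw [← show insert x a = insert y a from hxy]; simp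
    simpa [hx.2] using this

theorem le_card_filter_subset {α : Type*} [DecidableEq α] {t : Finset (Finset α)}
    {a : Finset α} (ht : ∀ x ∈ a, a.erase x ∈ t) :
    #a ≤ #{b ∈ t | b ⊆ a} := by
  rw [← card_image_of_injOn (s := a) (f := a.erase) (erase_injOn a)]
  refine card_le_card fun b hb => ?_
  obtain ⟨x, hx, rfl⟩ := mem_image.1 hb
  exact mem_filter.2 ⟨ht x hx, erase_subset _ _⟩

theorem isInitSeg_powersetCard_Iio {n : ℕ} (r : ℕ) (a : Fin n) :
    IsInitSeg (powersetCard r (Iio a)) r := by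
  refine ⟨Set.sized_powersetCard _ _, fun s t hs ht => ?_⟩
  rw [mem_powersetCard] at hs ⊢
  refine ⟨fun x hx => mem_Iio.2 ?_, ht.2⟩
  exact Colex.forall_lt_mono ht.1.le (fun b hb => mem_Iio.1 (hs.1 hb)) x hx

theorem exists_isInitSeg_card {α : Type*} [Fintype α] [LinearOrder α] (r c : ℕ)
    (hc : c ≤ (Fintype.card α).choose r) :
    ∃ I : Finset (Finset α), IsInitSeg I r ∧ #I = c := by
  induction c with
  | zero => exact ⟨∅, isInitSeg_empty, rfl⟩
  | succ c ih =>
    obtain ⟨I, hI, rfl⟩ := ih (by omega)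
    have hne : (powersetCard r univ \ I).Nonempty := by
      rw [sdiff_nonempty]
      intro h
      have := card_le_card h
      rw [card_powersetCard, card_univ] at this
      omega
    obtain ⟨s, hs, hmin⟩ := exists_min_image _ toColex hne
    simp only [mem_sdiff, mem_powersetCard_univ] at hs hmin
    refine ⟨insert s I, ⟨?_, ?_⟩, card_insert_of_notMem hs.2⟩
    · intro t ht
      rcases mem_insert.1 ht with rfl | ht
      exacts [hs.1, hI.1 ht]
    · intro u t hu ht
      by_cases htI : t ∈ I
      · exact mem_insert_of_mem htI
      rcases mem_insert.1 hu with rfl | hu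
      · exact absurd ht.1 (hmin t ⟨ht.2, htI⟩).not_gt
      · exact absurd (hI.2 hu ht) htI

/-- The shadow of a nonempty family of `k`-sets is larger than the family by at least two, as long as
the family is smaller than the family of all `k`-subsets of `[2k-1]` by at least two. -/
theorem card_add_two_le_card_shadow {k : ℕ} (hk : 3 ≤ k) {𝒜 : Finset (Finset (Fin (2 * k + 1)))}
    (h𝒜 : (𝒜 : Set (Finset (Fin (2 * k + 1)))).Sized k) (hne : 𝒜.Nonempty)
    (hle : #𝒜 + 2 ≤ (2 * k - 1).choose k) : #𝒜 + 2 ≤ #(∂ 𝒜) := by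
  obtain ⟨I, hI, hcard⟩ := exists_isInitSeg_card (α := Fin (2 * k + 1)) k #𝒜 (by
    rw [Fintype.card_fin]
    exact (by omega : #𝒜 ≤ (2 * k - 1).choose k).trans (Nat.choose_le_choose _ (by omega)))
  refine le_trans ?_ (kruskal_katona h𝒜 hcard.le hI)
  rw [← hcard] at hle ⊢
  replace hne : I.Nonempty := by rw [← card_pos] at hne ⊢; omega
  clear hcard h𝒜 𝒜
  let t : Fin (2 * k + 1) := ⟨2 * k - 2, by omega⟩
  let a : Fin (2 * k + 1) := ⟨2 * k - 1, by omega⟩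
  have hta : Iio a = insert t (Iio t) := by
    ext x
    simp only [mem_Iio, mem_insert, a, t, Fin.lt_def, Fin.ext_iff]
    omega
  have hcardt : #(Iio t) = 2 * k - 2 := by simp [t]
  have hcarda : #(Iio a) = 2 * k - 1 := by simp [a]
  have hsh : ∀ b ∈ ∂ I, #b = k - 1 := fun b hb => hI.1.shadow hb
  rcases hI.total (isInitSeg_powersetCard_Iio k t) with hsub | hsub
  · refine card_add_two_le_of_bipartite (d := k) (fun a b => b ⊆ a) hk ?_ ?_ ?_ hne
    · intro x hx
      have := le_card_filter_subset (t := ∂ I) fun y hy => erase_mem_shadow hx hy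
      rwa [hI.1 hx] at this
    · intro b hb
      obtain ⟨s, hs, hbs⟩ := exists_subset_of_mem_shadow hb
      have hv : ∀ a ∈ I, a ⊆ Iio t := fun a ha => (mem_powersetCard.1 (hsub ha)).1
      have := card_filter_superset_le (r := k - 1) (fun a ha => (hI.1 ha).trans (by omega))
        (hsh b hb) hv (hbs.trans (hv s hs))
      exact this.trans (by omega)
    · intro x hx x' hx' hxx b hb b' hb' h1 h2 h3 h4
      exact eq_of_common_subset (r := k - 1) ((hI.1 hx).trans (by omega))
        ((hI.1 hx').trans (by omega)) (hsh b hb) (hsh b' hb') hxx h1 h2 h3 h4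
  · have hIa : I ⊆ powersetCard k (Iio a) := by
      rcases hI.total (isInitSeg_powersetCard_Iio k a) with h | h
      · exact h
      · have := card_le_card h
        rw [card_powersetCard, hcarda] at this
        omega
    have hSa : ∂ I ⊆ powersetCard (k - 1) (Iio a) := by
      intro b hb
      obtain ⟨s, hs, hbs⟩ := exists_subset_of_mem_shadow hb
      exact mem_powersetCard.2 ⟨hbs.trans (mem_powersetCard.1 (hIa hs)).1, hsh b hb⟩
    set J := powersetCard k (Iio a) \ I with hJ
    set K := powersetCard (k - 1) (Iio a) \ ∂ I with hK
    have hJc : #J + #I = (2 * k - 1).choose k := by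
      rw [hJ, card_sdiff_add_card_eq_card hIa, card_powersetCard, hcarda]
    have hKc : #K + #(∂ I) = (2 * k - 1).choose k := by
      rw [hK, card_sdiff_add_card_eq_card hSa, card_powersetCard, hcarda]
      exact Nat.choose_symm_of_eq_add (by omega)
    suffices h : #K + 2 ≤ #J by omega
    rcases K.eq_empty_or_nonempty with h0 | hKne
    · rw [h0, card_empty]; omega
    have hKm : ∀ c ∈ K, c ⊆ Iio a ∧ #c = k - 1 ∧ c ∉ ∂ I := fun c hc => by
      simpa [hK, and_assoc] using hc
    have hJm : ∀ c ∈ J, c ⊆ Iio a ∧ #c = k := fun c hc => by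
      rw [hJ, mem_sdiff, mem_powersetCard] at hc; exact hc.1
    have htK : ∀ c ∈ K, t ∈ c := by
      intro c hc
      by_contra htc
      have hct : c ⊆ Iio t := by
        have := (hKm c hc).1
        rwa [hta, subset_insert_iff_of_notMem htc] at this
      obtain ⟨x, hx⟩ : (Iio t \ c).Nonempty := by
        rw [← card_pos, card_sdiff_of_subset hct, hcardt, (hKm c hc).2.1]; omega
      rw [mem_sdiff] at hx
      refine (hKm c hc).2.2 (mem_shadow_iff_insert_mem.2 ⟨x, hx.2, hsub ?_⟩)
      refine mem_powersetCard.2 ⟨insert_subset hx.1 hct, ?_⟩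
      rw [card_insert_of_notMem hx.2, (hKm c hc).2.1]; omega
    refine card_add_two_le_of_bipartite (d := k) (fun a b => a ⊆ b) hk ?_ ?_ ?_ hKne
    · intro c hc
      have : #(Iio a \ c) = k := by
        rw [card_sdiff_of_subset (hKm c hc).1, hcarda, (hKm c hc).2.1]; omega
      refine this.symm.le.trans (le_card_filter_superset fun x hx => ?_)
      rw [mem_sdiff] at hx
      refine mem_sdiff.2 ⟨mem_powersetCard.2 ⟨insert_subset hx.1 (hKm c hc).1, ?_⟩, fun h => ?_⟩
      · rw [card_insert_of_notMem hx.2, (hKm c hc).2.1]; omega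
      · exact (hKm c hc).2.2 (mem_shadow_iff_insert_mem.2 ⟨x, hx.2, h⟩)
    · intro b hb
      rcases (K.bipartiteBelow (fun a b => a ⊆ b) b).eq_empty_or_nonempty with h0 | ⟨c, hc⟩
      · rw [h0]; simp
      rw [mem_bipartiteBelow] at hc
      have := card_filter_subset_le (r := k - 1) (s := K) (u := {t}) (fun a ha => (hKm a ha).2.1)
        ((hJm b hb).2.trans (by omega)) (fun a ha _ => singleton_subset_iff.2 (htK a ha))
        (singleton_subset_iff.2 (hc.2 (htK c hc.1)))
      rw [card_singleton] at this
      exact this.trans (by omega)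
    · intro x hx x' hx' hxx b hb b' hb' h1 h2 h3 h4
      exact eq_of_common_superset (r := k - 1) (hKm x hx).2.1 (hKm x' hx').2.1
        ((hJm b hb).2.trans (by omega)) ((hJm b' hb').2.trans (by omega)) hxx h1 h2 h3 h4

theorem sized_or_card_add_two_le {m : ℕ} (hm : 6 ≤ m) (j : ℕ) (F : Finset (Finset (Fin m)))
    (hF : ∀ A ∈ F, m / 2 ≤ #A + j ∧ #A ≤ m / 2)
    (hInt : (F : Set (Finset (Fin m))).Intersecting)
    (hanti : ∀ A ∈ F, ∀ B ∈ F, A ⊆ B → A = B) :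
    (F : Set (Finset (Fin m))).Sized (m / 2) ∨ #F + 2 ≤ (m - 1).choose (m / 2 - 1) := by
  induction j generalizing F with
  | zero => exact Or.inl fun A hA => le_antisymm (hF A hA).2 (hF A hA).1
  | succ j ih =>
    set L := {A ∈ F | #A + (j + 1) = m / 2} with hL
    have hLm : ∀ A, A ∈ L ↔ A ∈ F ∧ #A + (j + 1) = m / 2 := fun A => by simp [hL]
    have hFL : ∀ A ∈ F \ L, A ∈ F ∧ m / 2 ≤ #A + j := by
      intro A hA
      rw [mem_sdiff, hLm] at hA
      have := hF A hA.1
      exact ⟨hA.1, by by_contra; exact hA.2 ⟨hA.1, by omega⟩⟩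
    rcases L.eq_empty_or_nonempty with h0 | hne
    · rw [h0, sdiff_empty] at hFL
      exact ih F (fun A hA => ⟨(hFL A hA).2, (hF A hA).2⟩) hInt hanti
    have hr : j + 1 ≤ m / 2 := by
      obtain ⟨A, hA⟩ := hne
      have := ((hLm A).1 hA).2
      omega
    have hLc : ∀ A ∈ L, #A = m / 2 - (j + 1) := fun A hA => by
      have := ((hLm A).1 hA).2
      omega
    have hUc : ∀ B ∈ ∂⁺ L, #B = m / 2 - (j + 1) + 1 := fun B hB =>
      Set.Sized.upShadow (fun A hA => hLc A hA) hB
    have hU : #L + 2 ≤ #(∂⁺ L) := by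
      refine card_add_two_le_of_bipartite (d := m - (m / 2 - (j + 1))) (fun a b => a ⊆ b)
        (by omega) ?_ ?_ ?_ hne
      · intro A hA
        have := le_card_filter_superset (t := ∂⁺ L) (a := A) (v := univ) fun x hx =>
          insert_mem_upShadow hA (mem_sdiff.1 hx).2
        rw [card_sdiff_of_subset (subset_univ _), hLc A hA, card_univ, Fintype.card_fin] at this
        exact this
      · intro B hB
        have := card_filter_subset_le hLc (hUc B hB) (u := ∅) (fun _ _ _ => empty_subset _)
          (empty_subset _)
        rw [card_empty] at this
        exact this.trans (by omega)
      · intro x hx x' hx' hxx b hb b' hb' h1 h2 h3 h4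
        exact eq_of_common_superset (hLc x hx) (hLc x' hx') (hUc b hb) (hUc b' hb') hxx h1 h2 h3 h4
    have hnot : ∀ A ∈ F \ L, ∀ B ∈ ∂⁺ L, ¬ B ⊆ A := by
      intro A hA B hB hBA
      obtain ⟨D, hD, hDB⟩ := exists_subset_of_mem_upShadow hB
      have := hanti D ((hLm D).1 hD).1 A (hFL A hA).1 (hDB.trans hBA)
      subst this
      exact (mem_sdiff.1 hA).2 hD
    have hdisj : Disjoint (F \ L) (∂⁺ L) :=
      disjoint_left.2 fun A hA hA' => hnot A hA A hA' Subset.rfl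
    have hcard : #F + 2 ≤ #(F \ L ∪ ∂⁺ L) := by
      rw [card_union_of_disjoint hdisj]
      have := card_sdiff_add_card_eq_card (filter_subset (fun A => #A + (j + 1) = m / 2) F)
      rw [← hL] at this
      omega
    have hbelow : ∀ A ∈ F \ L ∪ ∂⁺ L, ∃ B ∈ F, B ⊆ A := by
      intro A hA
      rcases mem_union.1 hA with h | h
      · exact ⟨A, (hFL A h).1, Subset.rfl⟩
      · obtain ⟨D, hD, hDB⟩ := exists_subset_of_mem_upShadow h
        exact ⟨D, ((hLm D).1 hD).1, hDB⟩
    have hInt' : ((F \ L ∪ ∂⁺ L : Finset (Finset (Fin m))) : Set (Finset (Fin m))).Intersecting := by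
      intro A hA B hB hAB
      obtain ⟨A', hA', hAA⟩ := hbelow A hA
      obtain ⟨B', hB', hBB⟩ := hbelow B hB
      exact hInt hA' hB' (hAB.mono hAA hBB)
    have key := ih (F \ L ∪ ∂⁺ L) ?_ hInt' ?_
    · right
      rcases key with h | h
      · exact hcard.trans (erdos_ko_rado hInt' h le_rfl)
      · omega
    · intro A hA
      rcases mem_union.1 hA with h | h
      · exact ⟨(hFL A h).2, (hF A (hFL A h).1).2⟩
      · have := hUc A h
        omega
    · intro A hA B hB hAB
      rcases mem_union.1 hA with h | h <;> rcases mem_union.1 hB with h' | h'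
      · exact hanti A (hFL A h).1 B (hFL B h').1 hAB
      · refine eq_of_subset_of_card_le hAB ?_
        have := hUc B h'
        have := (hFL A h).2
        omega
      · exact absurd hAB (hnot B h' A h)
      · exact eq_of_subset_of_card_le hAB (by rw [hUc A h, hUc B h'])

/-- A near-extremal intersecting family of `k`-sets in `[2k+1]` is a star. -/
theorem exists_forall_mem_of_intersecting {k : ℕ} (hk : 3 ≤ k)
    {F : Finset (Finset (Fin (2 * k + 1)))}
    (hInt : (F : Set (Finset (Fin (2 * k + 1)))).Intersecting)
    (hF : (F : Set (Finset (Fin (2 * k + 1)))).Sized k)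
    (hcard : #F + 1 = (2 * k).choose (k - 1)) : ∃ x, ∀ A ∈ F, x ∈ A := by
  by_contra! hno
  have hT : ∀ x, (2 * k - 1).choose k ≤ #{A ∈ F | x ∉ A} + 1 := by
    intro x
    set A' := {A ∈ F | x ∈ A}.image (erase · x) with hA'
    set B' := {A ∈ F | x ∉ A}.image (fun A => (insert x A)ᶜ) with hB'
    have hcA : #A' = #{A ∈ F | x ∈ A} := by
      refine card_image_of_injOn fun S hS T hT h => ?_
      simp only [coe_filter, Set.mem_ofPred_eq] at hS hT
      rw [← insert_erase hS.2, ← insert_erase hT.2, show S.erase x = T.erase x from h]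
    have hcB : #B' = #{A ∈ F | x ∉ A} := by
      refine card_image_of_injOn fun S hS T hT h => ?_
      simp only [coe_filter, Set.mem_ofPred_eq] at hS hT
      rw [← erase_insert hS.2, ← erase_insert hT.2, compl_injective h]
    have hsB : (B' : Set (Finset (Fin (2 * k + 1)))).Sized k := by
      intro S hS
      obtain ⟨A, hA, rfl⟩ := mem_image.1 hS
      rw [mem_filter] at hA
      rw [card_compl, card_insert_of_notMem hA.2, hF hA.1, Fintype.card_fin]
      omega
    have hdisj : Disjoint A' (∂ B') := by
      refine disjoint_left.2 fun S hS hS' => ?_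
      obtain ⟨A, hA, rfl⟩ := mem_image.1 hS
      obtain ⟨D, hD, hSD⟩ := exists_subset_of_mem_shadow hS'
      obtain ⟨B, hB, rfl⟩ := mem_image.1 hD
      rw [mem_filter] at hA hB
      refine hInt hA.1 hB.1 (disjoint_left.2 fun y hy hy' => ?_)
      have hyx : y ≠ x := by rintro rfl; exact hB.2 hy'
      have := hSD (mem_erase.2 ⟨hyx, hy⟩)
      simp [hy'] at this
    have hsub : A' ∪ ∂ B' ⊆ powersetCard (k - 1) (univ.erase x) := by
      refine union_subset (fun S hS => ?_) (fun S hS => ?_)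
      · obtain ⟨A, hA, rfl⟩ := mem_image.1 hS
        rw [mem_filter] at hA
        exact mem_powersetCard.2 ⟨erase_subset_erase _ (subset_univ _), by
          rw [card_erase_of_mem hA.2, hF hA.1]⟩
      · obtain ⟨D, hD, hSD⟩ := exists_subset_of_mem_shadow hS
        obtain ⟨B, hB, rfl⟩ := mem_image.1 hD
        refine mem_powersetCard.2 ⟨fun y hy => mem_erase.2 ⟨?_, mem_univ _⟩, hsB.shadow hS⟩
        rintro rfl
        simpa using hSD hy
    have hle := card_le_card hsub
    rw [card_union_of_disjoint hdisj, card_powersetCard, card_erase_of_mem (mem_univ _), card_univ,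
      Fintype.card_fin, Nat.add_sub_cancel, ← hcard] at hle
    have hsum := card_filter_add_card_filter_not (s := F) (fun A => x ∈ A)
    obtain ⟨A, hA, hxA⟩ := hno x
    have hne : B'.Nonempty := ⟨_, mem_image_of_mem _ (mem_filter.2 ⟨hA, hxA⟩)⟩
    by_contra! hlt
    have := card_add_two_le_card_shadow hk hsB hne (by omega)
    omega
  have hdc : ∑ x, #{A ∈ F | x ∉ A} = #F * (k + 1) := by
    have := sum_card_bipartiteAbove_eq_sum_card_bipartiteBelow (s := (univ : Finset (Fin (2 * k + 1))))
      (t := F) (fun x A => x ∉ A)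
    simp only [bipartiteAbove, bipartiteBelow] at this
    rw [this, sum_const_nat]
    intro A hA
    have h1 : ({x | x ∉ A} : Finset (Fin (2 * k + 1))) = Aᶜ := by ext; simp
    rw [h1, card_compl, hF hA, Fintype.card_fin]
    omega
  have hsumle : (2 * k + 1) * (2 * k - 1).choose k ≤ #F * (k + 1) + (2 * k + 1) := by
    have := sum_le_sum fun x (_ : x ∈ (univ : Finset (Fin (2 * k + 1)))) => hT x
    rw [sum_add_distrib, hdc] at this
    simpa using this
  have h1 : (2 * k).choose k = 2 * (2 * k - 1).choose k := by
    obtain ⟨j, rfl⟩ : ∃ j, k = j + 1 := ⟨k - 1, by omega⟩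
    rw [show 2 * (j + 1) = (2 * j + 1) + 1 by ring, Nat.choose_succ_succ, Nat.add_sub_cancel,
      Nat.choose_symm_half]
    ring
  have h2 : (2 * k).choose k * k = (2 * k).choose (k - 1) * (k + 1) := by
    have := Nat.choose_succ_right_eq (2 * k) (k - 1)
    rwa [Nat.sub_add_cancel (by omega), show 2 * k - (k - 1) = k + 1 by omega] at this
  have h3 : k + 1 ≤ (2 * k - 1).choose k := by
    rw [← Nat.choose_succ_self_right k]
    exact Nat.choose_le_choose _ (by omega)
  rw [← hcard, h1] at h2
  nlinarith

/-- Every membership pattern on two members of the family is realised by a point. -/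
def QualitativelyIndependent {α ι : Type*} (S : ι → Finset α) : Prop :=
  ∀ i j, i ≠ j → ∀ p q : Prop, ∃ r, (r ∈ S i ↔ p) ∧ (r ∈ S j ↔ q)

theorem QualitativelyIndependent.of_eq_or_compl {α ι : Type*} [Fintype α] [DecidableEq α]
    {S T : ι → Finset α} (hS : QualitativelyIndependent S)
    (hT : ∀ i, T i = S i ∨ T i = (S i)ᶜ) : QualitativelyIndependent T := by
  intro i j hij p q
  rcases hT i with hi | hi <;> rcases hT j with hj | hj <;> simp only [hi, hj, mem_compl]
  · exact hS i j hij p q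
  · obtain ⟨r, h1, h2⟩ := hS i j hij p (¬ q)
    exact ⟨r, h1, by tauto⟩
  · obtain ⟨r, h1, h2⟩ := hS i j hij (¬ p) q
    exact ⟨r, by tauto, h2⟩
  · obtain ⟨r, h1, h2⟩ := hS i j hij (¬ p) (¬ q)
    exact ⟨r, by tauto, by tauto⟩

theorem QualitativelyIndependent.not_subset {α ι : Type*} {S : ι → Finset α}
    (hS : QualitativelyIndependent S) {i j : ι} (hij : i ≠ j) : ¬ S i ⊆ S j := by
  intro h
  obtain ⟨r, h1, h2⟩ := hS i j hij True False
  exact h2.1 (h (h1.2 trivial))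

theorem QualitativelyIndependent.injective {α ι : Type*} {S : ι → Finset α}
    (hS : QualitativelyIndependent S) : Function.Injective S := by
  intro i j h
  by_contra hij
  exact hS.not_subset hij h.le

theorem QualitativelyIndependent.exists_star {m n : ℕ} (hm : 6 ≤ m)
    (hn : n + 1 = (m - 1).choose (m / 2 - 1)) {S : Fin n → Finset (Fin m)}
    (hS : QualitativelyIndependent S) :
    ∃ (x : Fin m) (T : Fin n → Finset (Fin m)), (∀ i, T i = S i ∨ T i = (S i)ᶜ) ∧
      Function.Injective T ∧ ∀ i, x ∈ T i ∧ #(T i) = m / 2 := by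
  have hex : ∀ i, ∃ A, (A = S i ∨ A = (S i)ᶜ) ∧ #A ≤ m / 2 := by
    intro i
    by_cases h : #(S i) ≤ m / 2
    · exact ⟨_, Or.inl rfl, h⟩
    · refine ⟨_, Or.inr rfl, ?_⟩
      rw [card_compl, Fintype.card_fin]
      omega
  choose T hT hTc using hex
  have hTi := hS.of_eq_or_compl hT
  have hn2 : 2 ≤ n := by
    have h1 : (m / 2 - 1 + 1).choose (m / 2 - 1) ≤ (m - 1).choose (m / 2 - 1) :=
      Nat.choose_le_choose _ (by omega)
    rw [Nat.choose_succ_self_right] at h1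
    omega
  have hcard : #(univ.image T) = n := by
    rw [card_image_of_injective _ hTi.injective, card_univ, Fintype.card_fin]
  have hInt : ((univ.image T : Finset _) : Set (Finset (Fin m))).Intersecting := by
    intro A hA B hB hAB
    obtain ⟨i, -, rfl⟩ := mem_image.1 (mem_coe.1 hA)
    obtain ⟨j, -, rfl⟩ := mem_image.1 (mem_coe.1 hB)
    by_cases hij : i = j
    · subst hij
      have : Nontrivial (Fin n) := Fin.nontrivial_iff_two_le.2 hn2
      obtain ⟨j, hj⟩ := exists_ne i
      rw [disjoint_self_iff_empty] at hAB
      exact hTi.not_subset hj.symm (hAB ▸ empty_subset _)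
    · obtain ⟨r, h1, h2⟩ := hTi i j hij True True
      exact disjoint_left.1 hAB (h1.2 trivial) (h2.2 trivial)
  have hsized : ∀ i, #(T i) = m / 2 := by
    have := sized_or_card_add_two_le hm (m / 2) (univ.image T) ?_ hInt ?_
    · rcases this with h | h
      · exact fun i => h (by simp)
      · omega
    · intro A hA
      obtain ⟨i, -, rfl⟩ := mem_image.1 hA
      exact ⟨by omega, hTc i⟩
    · intro A hA B hB hAB
      obtain ⟨i, -, rfl⟩ := mem_image.1 hA
      obtain ⟨j, -, rfl⟩ := mem_image.1 hB
      by_contra hne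
      exact hTi.not_subset (fun h => hne (congrArg T h)) hAB
  obtain ⟨k, rfl | rfl⟩ := m.even_or_odd'
  · let z : Fin (2 * k) := ⟨0, by omega⟩
    have hU : ∀ i, (if z ∈ T i then T i else (T i)ᶜ) = T i ∨
        (if z ∈ T i then T i else (T i)ᶜ) = (T i)ᶜ := by
      intro i; split_ifs <;> simp
    refine ⟨z, fun i => if z ∈ T i then T i else (T i)ᶜ, fun i => ?_,
      (hTi.of_eq_or_compl hU).injective, fun i => ?_⟩
    · dsimp only
      rcases hU i with h | h <;> rcases hT i with h' | h' <;> rw [h, h'] <;> simp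
    · have := hsized i
      dsimp only
      split_ifs with h
      · exact ⟨h, this⟩
      · refine ⟨mem_compl.2 h, ?_⟩
        rw [card_compl, this, Fintype.card_fin]
        omega
  · rw [show (2 * k + 1) / 2 = k by omega] at *
    obtain ⟨x, hx⟩ := exists_forall_mem_of_intersecting (by omega) hInt
      (fun A hA => by
        obtain ⟨i, -, rfl⟩ := mem_image.1 (mem_coe.1 hA)
        exact hsized i) (by rw [hcard, hn]; rfl)
    exact ⟨x, T, hT, hTi.injective, fun i => ⟨hx _ (by simp), hsized i⟩⟩

/-- The matrix whose columns are the indicator vectors of a family of sets. -/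
def indicatorArray {m n : ℕ} (G : Fin n → Finset (Fin m)) (r : Fin m) (i : Fin n) : Fin 2 :=
  if r ∈ G i then 1 else 0

/-- Near-maximal covering arrays are equivalent to indicator arrays of families of `m / 2`-sets
through a prescribed point `z`. -/
theorem exists_eq_indicatorArray {m n : ℕ} (hm : 6 ≤ m)
    (hn : n + 1 = (m - 1).choose (m / 2 - 1)) (z : Fin m) {C : Fin m → Fin n → Fin 2}
    (hC : IsCoveringArray m n 2 2 C) :
    ∃ (G : Fin n → Finset (Fin m)) (σ : Equiv.Perm (Fin m)) (f : Fin n → Equiv.Perm (Fin 2)),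
      Function.Injective G ∧ (∀ i, z ∈ G i ∧ #(G i) = m / 2) ∧
        ∀ r i, C r i = f i (indicatorArray G (σ r) i) := by
  classical
  have hS : QualitativelyIndependent fun i => ({r | C r i = 1} : Finset (Fin m)) := by
    intro i j hij p q
    have hinj : Function.Injective ![i, j] := by
      intro a b hab
      fin_cases a <;> fin_cases b <;> simp_all
    obtain ⟨r, hr⟩ := hC ![i, j] hinj ![if p then 1 else 0, if q then 1 else 0]
    have h0 := hr 0
    have h1 := hr 1
    simp only [Matrix.cons_val_zero, Matrix.cons_val_one] at h0 h1
    refine ⟨r, ?_, ?_⟩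
    · simp only [mem_filter, mem_univ, true_and, h0]
      split_ifs <;> simp_all
    · simp only [mem_filter, mem_univ, true_and, h1]
      split_ifs <;> simp_all
  obtain ⟨x, T, hT, hTi, hTx⟩ := hS.exists_star hm hn
  let σ : Equiv.Perm (Fin m) := Equiv.swap x z
  refine ⟨fun i => (T i).map σ.toEmbedding, σ,
    fun i => if T i = ({r | C r i = 1} : Finset (Fin m)) then 1 else Equiv.swap 0 1,
    fun i j h => hTi (map_injective _ h), fun i => ⟨?_, ?_⟩, fun r i => ?_⟩
  · exact mem_map.2 ⟨x, (hTx i).1, by simp [σ]⟩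
  · rw [card_map, (hTx i).2]
  · have hmem : σ r ∈ (T i).map σ.toEmbedding ↔ r ∈ T i := by simp
    simp only [indicatorArray, hmem]
    have h01 : C r i = 0 ∨ C r i = 1 := by omega
    split_ifs with h h' h'
    · rw [h] at h'
      simpa using h'
    · rw [h] at h'
      simpa using h01.resolve_right (by simpa using h')
    · rw [(hT i).resolve_left h] at h'
      simpa using h01.resolve_right (by simpa using h')
    · rw [(hT i).resolve_left h] at h'
      simpa using h'

theorem card_filter_mem_card_eq {m k : ℕ} (hk : 1 ≤ k) (z : Fin m) :
    #{A : Finset (Fin m) | z ∈ A ∧ #A = k} = (m - 1).choose (k - 1) := by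
  have : #(powersetCard (k - 1) (univ.erase z)) = (m - 1).choose (k - 1) := by
    rw [card_powersetCard, card_erase_of_mem (mem_univ _), card_univ, Fintype.card_fin]
  rw [← this]
  refine card_bij' (fun A _ => A.erase z) (fun A _ => insert z A) ?_ ?_ ?_ ?_
  · intro A hA
    simp only [mem_filter, mem_univ, true_and] at hA
    exact mem_powersetCard.2 ⟨erase_subset_erase _ (subset_univ _), by
      rw [card_erase_of_mem hA.1, hA.2]⟩
  · intro A hA
    rw [mem_powersetCard] at hA
    have hz : z ∉ A := fun h => notMem_erase z univ (hA.1 h)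
    simp only [mem_filter, mem_univ, true_and, mem_insert_self, card_insert_of_notMem hz]
    omega
  · intro A hA
    simp only [mem_filter, mem_univ, true_and] at hA
    exact insert_erase hA.1
  · intro A hA
    rw [mem_powersetCard] at hA
    exact erase_insert fun h => notMem_erase z univ (hA.1 h)

theorem exists_perm_map_eq {α : Type*} [Fintype α] [DecidableEq α] {z : α} {A B : Finset α}
    (hA : z ∈ A) (hB : z ∈ B) (hAB : #A = #B) :
    ∃ π : Equiv.Perm α, π z = z ∧ A.map π.toEmbedding = B := by
  let e : {x // x ∈ A} ≃ {x // x ∈ B} := equivOfCardEq hAB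
  have he : ∀ x ∈ A, e.extendSubtype x ∈ B := e.extendSubtype_mem
  refine ⟨e.extendSubtype.trans (Equiv.swap (e.extendSubtype z) z), by simp, ?_⟩
  refine eq_of_subset_of_card_le (fun y hy => ?_) (by rw [card_map, hAB])
  obtain ⟨x, hx, rfl⟩ := mem_map.1 hy
  simp only [Equiv.coe_toEmbedding, Equiv.trans_apply, Equiv.swap_apply_def]
  split_ifs
  exacts [hB, he z hA, he x hx]

/-- A family of `n` sets in a star of size `n + 1` misses exactly one member. -/
theorem exists_missing {m n k : ℕ} (hk : 1 ≤ k) (hn : n + 1 = (m - 1).choose (k - 1)) {z : Fin m}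
    {G : Fin n → Finset (Fin m)} (hG : Function.Injective G) (hGz : ∀ i, z ∈ G i ∧ #(G i) = k) :
    ∃ A, z ∈ A ∧ #A = k ∧ ∀ B, z ∈ B → #B = k → ((∃ i, G i = B) ↔ B ≠ A) := by
  have hsub : univ.image G ⊆ ({A | z ∈ A ∧ #A = k} : Finset (Finset (Fin m))) := by
    intro A hA
    obtain ⟨i, -, rfl⟩ := mem_image.1 hA
    simpa using hGz i
  obtain ⟨A, hA⟩ : ∃ A, ({A | z ∈ A ∧ #A = k} : Finset (Finset (Fin m))) \ univ.image G = {A} := by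
    rw [← card_eq_one, card_sdiff_of_subset hsub, card_filter_mem_card_eq hk, ← hn,
      card_image_of_injective _ hG, card_univ, Fintype.card_fin, Nat.add_sub_cancel_left]
  have hmem : ∀ B, ((z ∈ B ∧ #B = k) ∧ ∀ i, G i ≠ B) ↔ B = A := by
    intro B
    rw [← mem_singleton (a := A), ← hA]
    simp
  have := (hmem A).2 rfl
  refine ⟨A, this.1.1, this.1.2, fun B hB hBk => ?_⟩
  rw [Ne, ← hmem B]
  simp [hB, hBk]

end CoveringArray

open CoveringArray Finset in
/-- for `m ≥ 6` and `n = binom(m-1, ⌊m/2⌋-1) - 1`, every `m × n` binary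
2-covering array is equivalent to a matrix obtained by deleting one column from the
standard maximal binary 2-covering array of size `m` (an injective selection of the
`n = binom - 1` remaining columns); consequently any two such arrays are equivalent. -/
theorem near_maximal_unique (m n : ℕ) (hm : 6 ≤ m)
    (hn : n = (m-1).choose (m/2 - 1) - 1)
    (C : Fin m → Fin n → Fin 2) (hC : IsCoveringArray m n 2 2 C) :
    (∃ (S : Fin m → Fin ((m-1).choose (m/2 - 1)) → Fin 2)
       (g : Fin n → Fin ((m-1).choose (m/2 - 1))),
      IsStandardMaxArray m S ∧ Function.Injective g ∧
        CAEquiv C (fun r i => S r (g i))) ∧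
    (∀ C' : Fin m → Fin n → Fin 2, IsCoveringArray m n 2 2 C' → CAEquiv C C') := by
  have hpos : 0 < (m - 1).choose (m / 2 - 1) := Nat.choose_pos (by omega)
  have hn' : n + 1 = (m - 1).choose (m / 2 - 1) := by omega
  have hk : 1 ≤ m / 2 := by omega
  let z : Fin m := ⟨0, by omega⟩
  obtain ⟨G, σ, f, hG, hGz, hCG⟩ := exists_eq_indicatorArray hm hn' z hC
  refine ⟨?_, fun C' hC' => ?_⟩
  · let e : {A : Finset (Fin m) // z ∈ A ∧ #A = m / 2} ≃ Fin ((m - 1).choose (m / 2 - 1)) :=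
      Fintype.equivFinOfCardEq (by rw [Fintype.card_subtype, card_filter_mem_card_eq hk])
    refine ⟨indicatorArray fun i => (e.symm i : Finset (Fin m)), fun i => e ⟨G i, hGz i⟩,
      ⟨fun r i hr => ?_, fun i j hij => ?_, fun i => ?_⟩, fun i j hij => ?_,
      σ⁻¹, 1, fun i => (f i)⁻¹, fun r i => ?_⟩
    · have hz : r = z := Fin.ext hr
      simp [indicatorArray, hz, (e.symm i).2.1]
    · refine e.symm.injective (Subtype.ext (Finset.ext fun r => ?_))
      have := congrFun hij r
      simp only [indicatorArray] at this
      split_ifs at this <;> simp_all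
    · have : ({r : Fin m | (r : ℕ) ≠ 0 ∧ indicatorArray (fun i => (e.symm i : Finset (Fin m))) r i = 1}
          : Finset (Fin m)) = (e.symm i : Finset (Fin m)).erase z := by
        ext r
        simp [indicatorArray, z, Fin.ext_iff]
      rw [this, card_erase_of_mem (e.symm i).2.1, (e.symm i).2.2]
    · exact hG (congrArg Subtype.val (e.injective hij))
    · simp [hCG, indicatorArray]
  · obtain ⟨G', σ', f', hG', hGz', hCG'⟩ := exists_eq_indicatorArray hm hn' z hC'
    obtain ⟨A, hzA, hA, hAG⟩ := exists_missing hk hn' hG hGz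
    obtain ⟨A', hzA', hA', hAG'⟩ := exists_missing hk hn' hG' hGz'
    obtain ⟨π, hπz, hπ⟩ := exists_perm_map_eq hzA hzA' (hA.trans hA'.symm)
    have hmatch : ∀ i, ∃ j, (G j).map π.toEmbedding = G' i := by
      intro i
      have hback : ((G' i).map π.symm.toEmbedding).map π.toEmbedding = G' i := by
        ext; simp
      have hz : z ∈ (G' i).map π.symm.toEmbedding :=
        mem_map.2 ⟨z, (hGz' i).1, π.symm_apply_eq.2 hπz.symm⟩
      obtain ⟨j, hj⟩ := (hAG _ hz (by rw [card_map, (hGz' i).2])).2 fun h => by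
        rw [h, hπ] at hback
        exact (hAG' A' hzA' hA').1 ⟨i, hback.symm⟩ rfl
      exact ⟨j, by rw [hj, hback]⟩
    choose τ hτ using hmatch
    have hτi : Function.Injective τ := fun i j hij => hG' (by rw [← hτ i, ← hτ j, hij])
    refine ⟨σ'.trans (π.symm.trans σ.symm), Equiv.ofBijective τ (Finite.injective_iff_bijective.1 hτi),
      fun i => (f (τ i)).symm.trans (f' i), fun r i => ?_⟩
    rw [hCG', hCG]
    simp [indicatorArray, ← hτ i]
end

section
/- There is no 14 × 16 binary 3-covering array; equivalently, CAN(3,16,2) ≥ 15, i.e., every m × 16 binary 3-covering array has m ≥ 15. -/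
open Finset

/-- A family of sets is qualitatively independent if any two of its members, taken at distinct
indices, realise all four membership patterns. -/
def QualIndep {ι α : Type*} (A : ι → Finset α) : Prop :=
  ∀ ⦃i j⦄, i ≠ j → ∀ p q : Prop, ∃ x, (x ∈ A i ↔ p) ∧ (x ∈ A j ↔ q)

/-- The analogue of `QualIndep` for triples of members. -/
def QualIndepThree {κ α : Type*} (S : κ → Finset α) : Prop :=
  ∀ ⦃i j k⦄, i ≠ j → i ≠ k → j ≠ k → ∀ p q s : Prop,
    ∃ x, (x ∈ S i ↔ p) ∧ (x ∈ S j ↔ q) ∧ (x ∈ S k ↔ s)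

section Complement

variable {ι α : Type*} [Fintype α] [DecidableEq α]

/-- Replace the members indexed by `i` with `s i` by their complements. -/
def flipFamily (s : ι → Prop) [DecidablePred s] (A : ι → Finset α) (i : ι) : Finset α :=
  if s i then (A i)ᶜ else A i

lemma exists_mem_flipFamily_iff (s : ι → Prop) [DecidablePred s] (A : ι → Finset α) (i : ι)
    (p : Prop) : ∃ p' : Prop, ∀ x, (x ∈ A i ↔ p') → (x ∈ flipFamily s A i ↔ p) := by
  by_cases h : s i
  · exact ⟨¬ p, fun x hx => by simp [flipFamily, h, hx]⟩
  · exact ⟨p, fun x hx => by simp [flipFamily, h, hx]⟩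

lemma QualIndep.flip {A : ι → Finset α} (hA : QualIndep A) (s : ι → Prop)
    [DecidablePred s] : QualIndep (flipFamily s A) := by
  intro i j hij p q
  obtain ⟨p', hp⟩ := exists_mem_flipFamily_iff s A i p
  obtain ⟨q', hq⟩ := exists_mem_flipFamily_iff s A j q
  obtain ⟨x, h1, h2⟩ := hA hij p' q'
  exact ⟨x, hp x h1, hq x h2⟩

lemma QualIndepThree.flip {S : ι → Finset α} (hS : QualIndepThree S) (s : ι → Prop)
    [DecidablePred s] : QualIndepThree (flipFamily s S) := by
  intro i j k hij hik hjk p q r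
  obtain ⟨p', hp⟩ := exists_mem_flipFamily_iff s S i p
  obtain ⟨q', hq⟩ := exists_mem_flipFamily_iff s S j q
  obtain ⟨r', hr⟩ := exists_mem_flipFamily_iff s S k r
  obtain ⟨x, h1, h2, h3⟩ := hS hij hik hjk p' q' r'
  exact ⟨x, hp x h1, hq x h2, hr x h3⟩

end Complement

section Pairs

variable {ι α : Type*} {A : ι → Finset α}

lemma QualIndep.not_subset (hA : QualIndep A) {i j : ι} (hij : i ≠ j) : ¬ A i ⊆ A j := by
  obtain ⟨x, h1, h2⟩ := hA hij True False
  intro h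
  simp_all [h (by simpa using h1)]

lemma QualIndep.inter_nonempty [DecidableEq α] (hA : QualIndep A) {i j : ι} (hij : i ≠ j) :
    (A i ∩ A j).Nonempty := by
  obtain ⟨x, h1, h2⟩ := hA hij True True
  exact ⟨x, by simp_all⟩

lemma QualIndep.injective (hA : QualIndep A) : Function.Injective A := by
  intro i j h
  by_contra hij
  exact hA.not_subset hij h.subset

lemma QualIndep.two_le_card [Fintype ι] (hA : QualIndep A) (hι : 2 ≤ Fintype.card ι)
    (i : ι) : 2 ≤ #(A i) := by
  have : Nontrivial ι := Fintype.one_lt_card_iff_nontrivial.1 hι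
  obtain ⟨k, hk⟩ := exists_ne i
  obtain ⟨x, hx, hx'⟩ := hA hk.symm True True
  obtain ⟨y, hy, hy'⟩ := hA hk.symm True False
  exact one_lt_card.2 ⟨x, by simpa using hx, y, by simpa using hy, by rintro rfl; simp_all⟩

variable [Fintype ι] [Fintype α] [DecidableEq α]

/-- The members of a qualitatively independent family together with their complements form an
antichain, so Sperner's theorem bounds the size of the family. -/
lemma QualIndep.two_mul_card_le (hA : QualIndep A) (hι : 2 ≤ Fintype.card ι) :
    2 * Fintype.card ι ≤ (Fintype.card α).choose (Fintype.card α / 2) := by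
  classical
  let f : ι × Bool → Finset α := fun z => if z.2 then A z.1 else (A z.1)ᶜ
  have hsub : ∀ z w, f z ⊆ f w → z = w := by
    rintro ⟨i, a⟩ ⟨j, b⟩ h
    by_cases hij : i = j
    · subst hij
      have : Nontrivial ι := Fintype.one_lt_card_iff_nontrivial.1 hι
      obtain ⟨k, hk⟩ := exists_ne i
      obtain ⟨x, hx, -⟩ := hA hk.symm True True
      obtain ⟨y, hy, -⟩ := hA hk.symm False False
      have h1 := @h x
      have h2 := @h y
      cases a <;> cases b <;> simp_all [f]
    · obtain ⟨x, h1, h2⟩ := hA hij (a = true) (b = false)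
      have h3 := @h x
      cases a <;> cases b <;> simp_all [f]
  have hinj : Function.Injective f := fun z w h => hsub z w h.subset
  have hanti : IsAntichain (· ⊆ ·) (SetLike.coe (univ.image f)) := by
    intro s hs t ht hst h
    simp only [coe_image, coe_univ, Set.image_univ, Set.mem_range] at hs ht
    obtain ⟨z, rfl⟩ := hs
    obtain ⟨w, rfl⟩ := ht
    exact hst (congrArg f (hsub z w h))
  have := hanti.sperner
  rw [card_image_of_injective _ hinj] at this
  simpa [mul_comm] using this

lemma QualIndep.seven_le_card (hA : QualIndep A) (hι : Fintype.card ι = 15) :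
    7 ≤ Fintype.card α := by
  have h := hA.two_mul_card_le (by omega)
  by_contra! hc
  generalize Fintype.card α = n at h hc
  rw [hι] at h
  interval_cases n <;> simp [Nat.choose] at h

end Pairs

section SevenPoints

variable {ι α : Type*} [Fintype ι] [Fintype α] [DecidableEq α]

lemma card_le_fifteen_of_intersecting (hα : Fintype.card α = 7) {F : Finset (Finset α)}
    (hF : (F : Set (Finset α)).Intersecting) (hs : ∀ s ∈ F, #s = 3) : #F ≤ 15 := by
  let e : α ≃ Fin 7 := Fintype.equivFinOfCardEq hα
  let g : Finset α → Finset (Fin 7) := fun s => s.map e.toEmbedding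
  have hg : Function.Injective g := map_injective _
  rw [← card_image_of_injective F hg]
  refine (erdos_ko_rado (n := 7) (r := 3) ?_ ?_ (by norm_num)).trans (by simp [Nat.choose])
  · intro s hs t ht
    simp only [coe_image, Set.mem_image] at hs ht
    obtain ⟨s, hs, rfl⟩ := hs
    obtain ⟨t, ht, rfl⟩ := ht
    simpa [g] using hF hs ht
  · intro s hs
    simp only [coe_image, Set.mem_image] at hs
    obtain ⟨s, h, rfl⟩ := hs
    simpa [g] using hs s h

/-- Double counting of the incidences between 2-sets and the 3-sets containing them. -/
lemma five_mul_card_le (hα : Fintype.card α = 7) (P : Finset (Finset α))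
    (hP : ∀ s ∈ P, #s = 2) :
    #P * 5 ≤ #{t ∈ powersetCard 3 (univ : Finset α) | ∃ s ∈ P, s ⊆ t} * 3 := by
  refine card_mul_le_card_mul (fun s t => s ⊆ t) ?_ ?_
  · intro s hs
    have h5 : #(sᶜ) = 5 := by rw [card_compl, hα, hP s hs]
    rw [← h5]
    refine card_le_card_of_injOn (fun x => insert x s) ?_ ?_
    · intro x hx
      simp only [coe_compl, Set.mem_compl_iff, mem_coe] at hx
      simp only [bipartiteAbove, coe_filter, mem_filter, mem_powersetCard, subset_univ, true_and,
        Set.mem_ofPred_eq]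
      exact ⟨⟨by rw [card_insert_of_notMem hx, hP s hs], s, hs, subset_insert _ _⟩,
        subset_insert _ _⟩
    · intro x hx y hy h
      simp only [coe_compl, Set.mem_compl_iff, mem_coe] at hx hy
      have : x ∈ insert y s := by
        rw [← show insert x s = insert y s from h]
        exact mem_insert_self _ _
      exact (mem_insert.1 this).resolve_right hx
  · intro t ht
    simp only [mem_filter, mem_powersetCard, subset_univ, true_and] at ht
    have h3 : #(powersetCard 2 t) = 3 := by rw [card_powersetCard, ht.1]; rfl
    rw [← h3]
    refine card_le_card fun s hs => ?_
    simp only [bipartiteBelow, mem_filter] at hs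
    exact mem_powersetCard.2 ⟨hs.2, hP s hs.1⟩

lemma QualIndep.card_eq_three_of_card_le {A : ι → Finset α} (hA : QualIndep A)
    (hι : Fintype.card ι = 15) (hα : Fintype.card α = 7) (h3 : ∀ i, #(A i) ≤ 3) (i : ι) :
    #(A i) = 3 := by
  classical
  have h2 := hA.two_le_card (by omega)
  by_contra hi
  have hsize : ∀ j, #(A j) = 2 ∨ #(A j) = 3 := fun j => by have := h2 j; have := h3 j; omega
  let F : Finset (Finset α) := univ.image A
  let P := {s ∈ F | #s = 2}
  let Q := {s ∈ F | #s = 3}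
  let U := {t ∈ powersetCard 3 (univ : Finset α) | ∃ s ∈ P, s ⊆ t}
  have hF : #F = 15 := by rw [card_image_of_injective _ hA.injective, card_univ, hι]
  have hPQ : #P + #Q = 15 := by
    rw [← hF, ← card_union_of_disjoint]
    · congr 1
      ext s
      simp only [P, Q, F, mem_union, mem_filter, mem_image, mem_univ, true_and]
      constructor
      · tauto
      · rintro ⟨j, rfl⟩
        have := hsize j
        grind
    · exact disjoint_filter.2 fun s _ h => by omega
  have hP0 : 0 < #P := card_pos.2 ⟨A i, by
    simp only [P, F, mem_filter, mem_image, mem_univ, true_and, exists_apply_eq_apply]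
    have := hsize i; omega⟩
  have hU : #P * 5 ≤ #U * 3 := five_mul_card_le hα P fun s hs => (mem_filter.1 hs).2
  have hQU : Disjoint Q U := by
    rw [disjoint_left]
    intro t ht htU
    simp only [P, Q, U, F, mem_filter, mem_image, mem_univ, true_and] at ht htU
    obtain ⟨⟨j, rfl⟩, hj⟩ := ht
    obtain ⟨-, s, ⟨⟨k, rfl⟩, hk⟩, hs⟩ := htU
    refine hA.not_subset (i := k) (j := j) ?_ hs
    rintro rfl
    omega
  have hsub : ∀ t ∈ Q ∪ U, #t = 3 ∧ ∃ j, A j ⊆ t := by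
    intro t ht
    simp only [P, Q, U, F, mem_union, mem_filter, mem_image, mem_univ, true_and,
      mem_powersetCard, subset_univ] at ht
    rcases ht with ⟨⟨j, rfl⟩, hj⟩ | ⟨hc, s, ⟨⟨k, rfl⟩, hk⟩, hs⟩
    · exact ⟨hj, j, Subset.rfl⟩
    · exact ⟨hc, k, hs⟩
  have hle : #(Q ∪ U) ≤ 15 := by
    refine card_le_fifteen_of_intersecting hα ?_ fun t ht => (hsub t ht).1
    intro s hs t ht hst
    obtain ⟨-, j, hj⟩ := hsub s hs
    obtain ⟨-, k, hk⟩ := hsub t ht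
    have hd : Disjoint (A j) (A k) := hst.mono hj hk
    by_cases hjk : j = k
    · subst hjk
      have := h2 j
      simp_all
    · exact (hA.inter_nonempty hjk).ne_empty (disjoint_iff_inter_eq_empty.1 hd)
  rw [card_union_of_disjoint hQU] at hle
  omega

lemma QualIndep.card_eq_three_or_four {A : ι → Finset α} (hA : QualIndep A)
    (hι : Fintype.card ι = 15) (hα : Fintype.card α = 7) (i : ι) :
    #(A i) = 3 ∨ #(A i) = 4 := by
  have hle : ∀ j, #(flipFamily (fun j => 4 ≤ #(A j)) A j) ≤ 3 := by
    intro j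
    unfold flipFamily
    split_ifs
    · rw [card_compl]; omega
    · omega
  have h := (hA.flip (fun j => 4 ≤ #(A j))).card_eq_three_of_card_le hι hα hle i
  unfold flipFamily at h
  split_ifs at h
  · rw [card_compl] at h; omega
  · exact Or.inl h

/-- The evaluation at the set with indicator function `a` of a function on pairs which is
orthogonal to all functions induced from single points. -/
def pairWeight (a : α → ℤ) (x y : α) : ℤ := 1 - 2 * a x - 2 * a y + 5 * a x * a y

lemma sum_pairWeight_mul (hα : Fintype.card α = 7) {s t : Finset α} (hs : #s = 3) (ht : #t = 3)
    {a b : α → ℤ} (ha : a = fun x => if x ∈ s then 1 else 0)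
    (hb : b = fun x => if x ∈ t then 1 else 0) :
    ∑ x, ∑ y, pairWeight a x y * pairWeight b x y - ∑ x, pairWeight a x x * pairWeight b x x
      = 25 * (#(s ∩ t) : ℤ) ^ 2 - 65 * #(s ∩ t) + 30 := by
  have hsum : ∀ c₀ c₁ c₂ c₃ : ℤ, ∑ x, (c₀ + c₁ * a x + c₂ * b x + c₃ * (a x * b x))
      = 7 * c₀ + 3 * c₁ + 3 * c₂ + #(s ∩ t) * c₃ := by
    intro c₀ c₁ c₂ c₃
    have h1 : ∑ x, a x = 3 := by simp [ha, hs]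
    have h2 : ∑ x, b x = 3 := by simp [hb, ht]
    have h3 : ∑ x, a x * b x = #(s ∩ t) := by
      simp only [ha, hb, mul_ite, mul_one, mul_zero, ← ite_and, ← mem_inter]
      simp [inter_comm t s, -mem_inter]
    rw [sum_add_distrib, sum_add_distrib, sum_add_distrib, ← mul_sum, ← mul_sum, ← mul_sum,
      h1, h2, h3]
    simp [hα]
    ring
  have haa : ∀ x, a x * a x = a x := by intro x; simp [ha]
  have hbb : ∀ x, b x * b x = b x := by intro x; simp [hb]
  have hdiag : ∑ x, pairWeight a x x * pairWeight b x x = 13 + #(s ∩ t) := by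
    rw [sum_congr rfl fun x _ => show pairWeight a x x * pairWeight b x x
      = 1 + 1 * a x + 1 * b x + 1 * (a x * b x) by
        unfold pairWeight
        linear_combination (5 - 20 * b x + 25 * b x * b x) * haa x + (5 + 5 * a x) * hbb x, hsum]
    ring
  set k : ℤ := (#(s ∩ t) : ℤ)
  have hrow : ∀ x, ∑ y, pairWeight a x y * pairWeight b x y
      = 7 * ((1 - 2 * a x) * (1 - 2 * b x)) + 3 * ((5 * a x - 2) * (1 - 2 * b x))
        + 3 * ((1 - 2 * a x) * (5 * b x - 2)) + k * ((5 * a x - 2) * (5 * b x - 2)) := by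
    intro x
    rw [← hsum]
    refine sum_congr rfl fun y _ => ?_
    unfold pairWeight
    ring
  rw [hdiag, sum_congr rfl fun x _ => (hrow x).trans (show _ =
    (-5 + 4 * k) + (13 - 10 * k) * a x + (13 - 10 * k) * b x
      + (-32 + 25 * k) * (a x * b x) by ring), hsum]
  ring

lemma QualIndep.card_inter_eq_one_le {A : ι → Finset α} (hA : QualIndep A)
    (hι : Fintype.card ι = 15) (hα : Fintype.card α = 7) (h3 : ∀ i, #(A i) = 3) :
    #{p : ι × ι | #(A p.1 ∩ A p.2) = 1} ≤ 90 := by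
  classical
  let w : ι → α → α → ℤ := fun i => pairWeight fun x => if x ∈ A i then 1 else 0
  have hnonneg : 0 ≤ ∑ x, ∑ y, (∑ i, w i x y) ^ 2 - ∑ x, (∑ i, w i x x) ^ 2 := by
    rw [← sum_sub_distrib]
    refine sum_nonneg fun x _ => sub_nonneg.2 ?_
    exact single_le_sum (f := fun y => (∑ i, w i x y) ^ 2) (fun y _ => sq_nonneg _) (mem_univ x)
  have hexp : ∑ x, ∑ y, (∑ i, w i x y) ^ 2 - ∑ x, (∑ i, w i x x) ^ 2
      = ∑ p : ι × ι, (∑ x, ∑ y, w p.1 x y * w p.2 x y - ∑ x, w p.1 x x * w p.2 x x) := by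
    have hsq : ∀ x y, (∑ i, w i x y) ^ 2 = ∑ p : ι × ι, w p.1 x y * w p.2 x y := by
      intro x y
      rw [sq, sum_mul_sum, Fintype.sum_prod_type]
    simp only [hsq]
    rw [sum_sub_distrib]
    congr 1
    · rw [sum_congr rfl fun x _ => sum_comm, sum_comm]
    · exact sum_comm
  have hbound : ∀ p : ι × ι,
      ∑ x, ∑ y, w p.1 x y * w p.2 x y - ∑ x, w p.1 x x * w p.2 x x
        = (if p.1 = p.2 then 60 else 0) - (if #(A p.1 ∩ A p.2) = 1 then 10 else 0) := by
    rintro ⟨i, j⟩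
    rw [sum_pairWeight_mul hα (h3 i) (h3 j) rfl rfl]
    by_cases hij : i = j
    · subst hij
      simp [h3]
    · have hpos := card_pos.2 (hA.inter_nonempty hij)
      have hlt : #(A i ∩ A j) < 3 := by
        rw [← h3 i]
        refine card_lt_card ⟨inter_subset_left, fun h => hA.not_subset hij ?_⟩
        exact h.trans inter_subset_right
      simp only [hij, if_false]
      interval_cases h : #(A i ∩ A j) <;> simp
  rw [hexp, sum_congr rfl fun p _ => hbound p, sum_sub_distrib, Fintype.sum_prod_type] at hnonneg
  simp only [sum_ite_eq, mem_univ, if_true, sum_const, card_univ, hι, ← sum_filter] at hnonneg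
  simp only [nsmul_eq_mul] at hnonneg
  push_cast at hnonneg
  omega

end SevenPoints

section Traces

variable {κ α : Type*} [DecidableEq α] {S : κ → Finset α}

/-- The traces of all members of a family other than the `c`-th one on the set `R`. -/
def traceFamily (S : κ → Finset α) (c : κ) (R : Finset α) (i : {i // i ≠ c}) :
    Finset {x // x ∈ R} :=
  (S i).subtype (· ∈ R)

lemma card_traceFamily (S : κ → Finset α) (c : κ) (R : Finset α) (i : {i // i ≠ c}) :
    #(traceFamily S c R i) = #(S i ∩ R) := by
  rw [traceFamily, card_subtype, filter_mem_eq_inter]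

lemma card_traceFamily_inter (S : κ → Finset α) (c : κ) (R : Finset α) (i j : {i // i ≠ c}) :
    #(traceFamily S c R i ∩ traceFamily S c R j) = #(S i ∩ S j ∩ R) := by
  rw [← filter_mem_eq_inter (s := S i ∩ S j), ← card_subtype]
  congr 1
  ext x
  simp [traceFamily]

variable [Fintype α]

lemma QualIndepThree.trace (hS : QualIndepThree S) (c : κ) {R : Finset α}
    (hR : R = S c ∨ R = (S c)ᶜ) : QualIndep (traceFamily S c R) := by
  intro i j hij p q
  have hij' : (i : κ) ≠ j := fun h => hij (Subtype.ext h)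
  obtain ⟨x, h1, h2, h3⟩ := hS hij' i.2 j.2 p q (R = S c)
  have hne : S c ≠ (S c)ᶜ := fun h => by have := Finset.ext_iff.1 h x; simp at this
  have hx : x ∈ R := by
    rcases hR with rfl | rfl
    · simpa using h3
    · exact mem_compl.2 fun h => hne (h3.1 h).symm
  exact ⟨⟨x, hx⟩, by simpa [traceFamily] using h1, by simpa [traceFamily] using h2⟩

variable [Fintype κ] [DecidableEq κ]

lemma QualIndepThree.card_member (hS : QualIndepThree S) (hκ : Fintype.card κ = 16)
    (hα : Fintype.card α ≤ 14) (c : κ) : #(S c) = 7 ∧ #(S c)ᶜ = 7 := by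
  have hι : Fintype.card {i // i ≠ c} = 15 := by simp [Fintype.card_subtype_compl, hκ]
  have h1 := (hS.trace c (Or.inl rfl)).seven_le_card hι
  have h2 := (hS.trace c (Or.inr rfl)).seven_le_card hι
  rw [Fintype.card_coe] at h1 h2
  have := card_add_card_compl (S c)
  omega

lemma QualIndepThree.card_inter (hS : QualIndepThree S) (hκ : Fintype.card κ = 16)
    (hα : Fintype.card α ≤ 14) {i c : κ} (hic : i ≠ c) :
    #(S i ∩ S c) = 3 ∨ #(S i ∩ S c) = 4 := by
  have hι : Fintype.card {i // i ≠ c} = 15 := by simp [Fintype.card_subtype_compl, hκ]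
  rw [← card_traceFamily S c (S c) ⟨i, hic⟩]
  refine (hS.trace c (Or.inl rfl)).card_eq_three_or_four hι ?_ _
  rw [Fintype.card_coe, (hS.card_member hκ hα c).1]

lemma QualIndepThree.not_forall_card_inter_eq_three (hS : QualIndepThree S)
    (hκ : Fintype.card κ = 16) (hα : Fintype.card α ≤ 14) (c : κ)
    (h3 : ∀ i, i ≠ c → #(S i ∩ S c) = 3) : False := by
  have hι : Fintype.card {i // i ≠ c} = 15 := by simp [Fintype.card_subtype_compl, hκ]
  have hw := hS.card_member hκ hα
  let A := traceFamily S c (S c)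
  let B := fun i => (traceFamily S c (S c)ᶜ i)ᶜ
  have hA : QualIndep A := hS.trace c (Or.inl rfl)
  have hB : QualIndep B := by
    have h := (hS.trace c (Or.inr rfl)).flip fun _ => True
    unfold flipFamily at h
    simpa only [if_true] using h
  have hcA : Fintype.card {x // x ∈ S c} = 7 := by rw [Fintype.card_coe, (hw c).1]
  have hcB : Fintype.card {x // x ∈ (S c)ᶜ} = 7 := by rw [Fintype.card_coe, (hw c).2]
  have hsplit : ∀ s : Finset α, #(s ∩ S c) + #(s ∩ (S c)ᶜ) = #s := by
    intro s
    rw [← sdiff_eq_inter_compl]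
    exact card_inter_add_card_sdiff s (S c)
  have hA3 : ∀ i, #(A i) = 3 := fun i => by rw [card_traceFamily, h3 i i.2]
  have hT4 : ∀ i, #(traceFamily S c (S c)ᶜ i) = 4 := by
    intro i
    have := hsplit (S i)
    rw [h3 i i.2, (hw i).1] at this
    rw [card_traceFamily]
    omega
  have hB3 : ∀ i, #(B i) = 3 := by
    intro i
    rw [card_compl, hcB, hT4]
  have hA90 := hA.card_inter_eq_one_le hι hcA hA3
  have hB90 := hB.card_inter_eq_one_le hι hcB hB3
  obtain ⟨⟨i, j⟩, hij, hnot⟩ : ∃ p ∈ (univ : Finset {i // i ≠ c}).offDiag,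
      p ∉ (univ.filter fun p => #(A p.1 ∩ A p.2) = 1) ∪
        univ.filter fun p => #(B p.1 ∩ B p.2) = 1 := by
    refine exists_mem_notMem_of_card_lt_card (lt_of_le_of_lt (card_union_le _ _) ?_)
    rw [offDiag_card, card_univ, hι]
    omega
  simp only [mem_offDiag, mem_univ, true_and] at hij
  simp only [mem_union, mem_filter, mem_univ, true_and, not_or] at hnot
  have hpair : ∀ {β : Type _} [DecidableEq β] (s t : Finset β), #s = 3 → ¬ s ⊆ t →
      (s ∩ t).Nonempty → #(s ∩ t) ≠ 1 → #(s ∩ t) = 2 := by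
    intro β _ s t hs hst hne h1
    have hpos := card_pos.2 hne
    have : #(s ∩ t) < #s := card_lt_card
      ⟨inter_subset_left, fun h => hst (h.trans inter_subset_right)⟩
    omega
  have hA2 := hpair _ _ (hA3 i) (hA.not_subset hij) (hA.inter_nonempty hij) hnot.1
  have hB2 := hpair _ _ (hB3 i) (hB.not_subset hij) (hB.inter_nonempty hij) hnot.2
  rw [card_traceFamily_inter] at hA2
  rw [← compl_union, card_compl, hcB] at hB2
  have hun := card_union_add_card_inter (traceFamily S c (S c)ᶜ i)
    (traceFamily S c (S c)ᶜ j)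
  rw [hT4, hT4, card_traceFamily_inter] at hun
  have := hsplit (S i ∩ S j)
  rcases hS.card_inter hκ hα (i := i) (c := j) (fun h => hij (Subtype.ext h)) with h | h <;> omega

theorem QualIndepThree.fifteen_le_card (hS : QualIndepThree S) (hκ : Fintype.card κ = 16) :
    15 ≤ Fintype.card α := by
  by_contra! hlt
  have hα : Fintype.card α ≤ 14 := by omega
  have : Nonempty κ := Fintype.card_pos_iff.1 (by omega)
  obtain ⟨c⟩ := this
  let s : κ → Prop := fun i => i ≠ c ∧ #(S i ∩ S c) = 4
  refine (hS.flip s).not_forall_card_inter_eq_three hκ hα c fun i hi => ?_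
  have hc : flipFamily s S c = S c := by simp [flipFamily, s]
  rw [hc]
  have h34 := hS.card_inter hκ hα hi
  by_cases h : #(S i ∩ S c) = 4
  · have hf : flipFamily s S i = (S i)ᶜ := by simp [flipFamily, s, hi, h]
    have h1 := card_inter_add_card_sdiff (S c) (S i)
    rw [(hS.card_member hκ hα c).1, inter_comm, h, sdiff_eq_inter_compl, inter_comm] at h1
    rw [hf]
    omega
  · have hf : flipFamily s S i = S i := by simp [flipFamily, s, h]
    rw [hf]
    tauto

end Traces

lemma IsCoveringArray.qualIndepThree {m n : ℕ} {C : Fin m → Fin n → Fin 2}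
    (hC : IsCoveringArray m n 2 3 C) :
    QualIndepThree fun i => ({r | C r i = 1} : Finset (Fin m)) := by
  classical
  intro i j k hij hik hjk p q s
  have hinj : Function.Injective ![i, j, k] := by
    intro a b h
    fin_cases a <;> fin_cases b <;> simp_all
  obtain ⟨r, hr⟩ := hC ![i, j, k] hinj
    ![if p then 1 else 0, if q then 1 else 0, if s then 1 else 0]
  refine ⟨r, ?_, ?_, ?_⟩
  · have := hr 0
    by_cases p <;> simp_all
  · have := hr 1
    by_cases q <;> simp_all
  · have := hr 2
    by_cases s <;> simp_all

/-- there is no `14 × 16` binary 3-covering array; equivalently every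
`m × 16` binary 3-covering array has `m ≥ 15`, i.e. `CAN(3,16,2) ≥ 15`. -/
theorem no_14_by_16 :
    (∀ C : Fin 14 → Fin 16 → Fin 2, ¬ IsCoveringArray 14 16 2 3 C) ∧
    (∀ (m : ℕ) (C : Fin m → Fin 16 → Fin 2), IsCoveringArray m 16 2 3 C → 15 ≤ m) := by
  have h : ∀ (m : ℕ) (C : Fin m → Fin 16 → Fin 2), IsCoveringArray m 16 2 3 C → 15 ≤ m :=
    fun m C hC => by simpa using hC.qualIndepThree.fifteen_le_card (Fintype.card_fin 16)
  exact ⟨fun C hC => absurd (h 14 C hC) (by norm_num), h⟩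
end
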